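/- arXiv:2204.03462 — 5 statements merged into one kernel-verified Lean document; each statement's English description precedes it below -/
import Mathlib

section
/- For all integers k ≥ 1, a ≥ 1 and p ≥ 2 there exist δ > 0 and n₀ such that for all n ≥ n₀ and all integers b with 1 ≤ b ≤ δ·ln n, the Ramsey number satisfies r(K_p(1,a,b,…,b), B_{k,n}) ≤ (p−1)(n−1) + k(p−1)(a−1) + 1, where K_p(1,a,b,…,b) is the complete p-partite graph with one part of size 1, one part of size a, and p−2 parts of size b. -/
open SimpleGraph

/-- `G` contains a copy of `H` (as a subgraph, i.e. there is an injective graph homomorphism). -/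
def HasCopy {V W : Type*} (G : SimpleGraph V) (H : SimpleGraph W) : Prop :=
  ∃ f : H →g G, Function.Injective f

/-- The Ramsey number `r(H₁, H₂)`: the smallest `N` such that every graph `G` on `N` vertices
contains `H₁` as a subgraph or its complement contains `H₂` as a subgraph. -/
noncomputable def ramseyNumber {V W : Type*} (H₁ : SimpleGraph V) (H₂ : SimpleGraph W) : ℕ :=
  sInf {N : ℕ | ∀ G : SimpleGraph (Fin N), HasCopy G H₁ ∨ HasCopy Gᶜ H₂}

/-- The complete multipartite graph `K_p(a₁,…,a_p)` with parts of sizes `a 0, …, a (p-1)`. -/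
def KMulti {p : ℕ} (a : Fin p → ℕ) : SimpleGraph (Σ i : Fin p, Fin (a i)) :=
  completeMultipartiteGraph fun i => Fin (a i)

/-- The book graph `B_{k,n}`: the join of `K_k` with an independent set of `n - k` vertices,
realized as the complete multipartite graph with `k` parts of size `1` and one part of
size `n - k`. -/
def Book (k n : ℕ) : SimpleGraph (Σ i : Fin (k + 1), Fin (if (i : ℕ) < k then 1 else n - k)) :=
  completeMultipartiteGraph fun i : Fin (k + 1) => Fin (if (i : ℕ) < k then 1 else n - k)

section
open Finset

variable {V : Type*}

/-- The sets `A i`, `i ∈ S`, are pairwise completely joined. -/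
def JoinedFam (G : SimpleGraph V) {ι : Type*} (S : Finset ι) (A : ι → Finset V) : Prop :=
  ∀ i ∈ S, ∀ j ∈ S, i ≠ j → ∀ x ∈ A i, ∀ y ∈ A j, G.Adj x y

theorem JoinedFam.mono {G : SimpleGraph V} {ι : Type*} {S : Finset ι} {A B : ι → Finset V}
    (h : JoinedFam G S A)
    (hB : ∀ i ∈ S, B i ⊆ A i) : JoinedFam G S B :=
  fun i hi j hj hij x hx y hy => h i hi j hj hij x (hB i hi hx) y (hB j hj hy)

theorem JoinedFam.update {G : SimpleGraph V} {ι : Type*} [DecidableEq ι] {S : Finset ι}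
    {A : ι → Finset V} (h : JoinedFam G S A) {i : ι} (hi : i ∉ S) {D : Finset V}
    (hD : ∀ j ∈ S, ∀ x ∈ D, ∀ y ∈ A j, G.Adj x y) :
    JoinedFam G (insert i S) (Function.update A i D) := by
  intro j hj l hl hjl x hx y hy
  rcases mem_insert.1 hj with rfl | hj' <;> rcases mem_insert.1 hl with rfl | hl'
  · exact absurd rfl hjl
  · rw [Function.update_self] at hx
    rw [Function.update_of_ne hjl.symm] at hy
    exact hD l hl' x hx y hy
  · rw [Function.update_self] at hy
    rw [Function.update_of_ne hjl] at hx
    exact (hD j hj' y hy x hx).symm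
  · rw [Function.update_of_ne (ne_of_mem_of_not_mem hj' hi)] at hx
    rw [Function.update_of_ne (ne_of_mem_of_not_mem hl' hi)] at hy
    exact h j hj' l hl' hjl x hx y hy

variable (G : SimpleGraph V) [DecidableRel G.Adj]

/-- A weak form of Ramsey's theorem: `2 ^ (s + t)` vertices contain a clique of size `s` or an
independent set of size `t`. -/
theorem exists_isClique_or_isIndepSet [DecidableEq V] (s t : ℕ) (S : Finset V)
    (hS : 2 ^ (s + t) ≤ #S) :
    (∃ C ⊆ S, #C = s ∧ G.IsClique (C : Set V)) ∨
      ∃ I ⊆ S, #I = t ∧ G.IsIndepSet (I : Set V) := by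
  induction s generalizing t S with
  | zero => exact Or.inl ⟨∅, by simp, by simp, by simp⟩
  | succ s ihs =>
  induction t generalizing S with
  | zero => exact Or.inr ⟨∅, by simp, by simp, by simp⟩
  | succ t iht =>
  obtain ⟨v, hv⟩ : S.Nonempty := card_pos.1 (lt_of_lt_of_le (by positivity) hS)
  have hsplit : #{x ∈ S.erase v | G.Adj v x} + #{x ∈ S.erase v | ¬ G.Adj v x} = #S - 1 := by
    rw [card_filter_add_card_filter_not, card_erase_of_mem hv]
  have e1 : 2 ^ (s + 1 + (t + 1)) = 2 * 2 ^ (s + (t + 1)) := by ring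
  have e2 : 2 ^ (s + 1 + t) = 2 ^ (s + (t + 1)) := by ring
  rcases le_or_gt (2 ^ (s + (t + 1))) #{x ∈ S.erase v | G.Adj v x} with h | h
  · rcases ihs (t + 1) _ h with ⟨C, hC, hc, hcl⟩ | ⟨I, hI, hc, hi⟩
    · have hvC : v ∉ C := fun hh => by simpa using hC hh
      refine Or.inl ⟨insert v C, ?_, by rw [card_insert_of_notMem hvC, hc], ?_⟩
      · exact insert_subset hv fun x hx => mem_of_mem_erase (mem_filter.1 (hC hx)).1
      · rw [coe_insert]
        exact hcl.insert fun x hx _ => (mem_filter.1 (hC hx)).2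
    · exact Or.inr ⟨I, fun x hx => mem_of_mem_erase (mem_filter.1 (hI hx)).1, hc, hi⟩
  · rcases iht {x ∈ S.erase v | ¬ G.Adj v x} (by omega) with ⟨C, hC, hc, hcl⟩ | ⟨I, hI, hc, hi⟩
    · exact Or.inl ⟨C, fun x hx => mem_of_mem_erase (mem_filter.1 (hC hx)).1, hc, hcl⟩
    · have hvI : v ∉ I := fun hh => by simpa using hI hh
      refine Or.inr ⟨insert v I, ?_, by rw [card_insert_of_notMem hvI, hc], ?_⟩
      · exact insert_subset hv fun x hx => mem_of_mem_erase (mem_filter.1 (hI hx)).1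
      · rw [coe_insert]
        refine hi.insert fun x hx _ => ?_
        have := (mem_filter.1 (hI hx)).2
        exact ⟨this, fun h => this h.symm⟩

/-- Many vertices share the same neighbourhood in a small set. -/
theorem exists_common_trace [DecidableEq V] (U Y : Finset V) (u m : ℕ) (hU : #U ≤ u)
    (hY : 2 ^ u * m ≤ #Y) :
    ∃ Y' ⊆ Y, m ≤ #Y' ∧ ∃ W : Finset V, ∀ y ∈ Y', ∀ x ∈ U, (G.Adj y x ↔ x ∈ W) := by
  obtain ⟨W, -, hW⟩ := exists_le_card_fiber_of_mul_le_card_of_maps_to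
    (s := Y) (t := U.powerset) (f := fun y => {x ∈ U | G.Adj y x}) (n := m)
    (fun y _ => by simp) ⟨∅, by simp⟩
    (le_trans (Nat.mul_le_mul_right _ (by
      rw [card_powerset]; exact Nat.pow_le_pow_right (by norm_num) hU)) hY)
  refine ⟨_, filter_subset _ _, hW, W, fun y hy x hx => ?_⟩
  rw [← (mem_filter.1 hy).2]
  simp [hx]

/-- The number of non-neighbours of `v` in `A`. -/
def miss (A : Finset V) (v : V) : ℕ := #{x ∈ A | ¬ G.Adj v x}

/-- The number of neighbours of `v` in `A`. -/
def hits (A : Finset V) (v : V) : ℕ := #{x ∈ A | G.Adj v x}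

theorem hits_add_miss (A : Finset V) (v : V) : hits G A v + miss G A v = #A :=
  card_filter_add_card_filter_not _

variable {G} in
theorem miss_mono {A B : Finset V} (h : A ⊆ B) (v : V) : miss G A v ≤ miss G B v :=
  card_le_card (filter_subset_filter _ h)

theorem sum_miss_comm (A W : Finset V) : ∑ v ∈ W, miss G A v = ∑ x ∈ A, miss G W x := by
  have := sum_card_bipartiteAbove_eq_sum_card_bipartiteBelow (s := W) (t := A)
    (fun v x => ¬ G.Adj v x)
  simpa [bipartiteAbove, bipartiteBelow, miss, G.adj_comm] using this

variable {G}

/-- Every joined family can be extended by a new set of vertices, at the cost of shrinking its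
members, as long as many vertices have large degree to every member. -/
theorem JoinedFam.exists_shrink [DecidableEq V] {ι : Type*} [DecidableEq ι] {S : Finset ι}
    {A : ι → Finset V} (h : JoinedFam G S A) {Y : Finset V} {u m : ℕ}
    (hA : ∀ i ∈ S, #(A i) ≤ u) (hY : 2 ^ (#S * u) * m ≤ #Y) :
    ∃ Y' ⊆ Y, m ≤ #Y' ∧ ∃ B : ι → Finset V, (∀ i ∈ S, B i ⊆ A i) ∧ JoinedFam G S B ∧
      (∀ i ∈ S, ∀ y ∈ Y', #(B i) = hits G (A i) y) ∧
      ∀ i ∈ S, ∀ y ∈ Y', ∀ x ∈ B i, G.Adj y x := by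
  obtain ⟨Y', hY', hm', W, hW⟩ := exists_common_trace G (S.biUnion A) Y (#S * u) m
    (card_biUnion_le_card_mul _ _ _ hA) hY
  refine ⟨Y', hY', hm', fun i => A i ∩ W, fun i _ => inter_subset_left,
    h.mono fun i _ => inter_subset_left, fun i hi y hy => ?_, fun i hi y hy x hx => ?_⟩
  · unfold hits
    congr 1
    ext x
    simp only [mem_inter, mem_filter]
    exact and_congr_right fun hx => (hW y hy x (mem_biUnion.2 ⟨i, hi, hx⟩)).symm
  · rw [mem_inter] at hx
    exact (hW y hy x (mem_biUnion.2 ⟨i, hi, hx.1⟩)).2 hx.2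

/-- Embedding lemma: if every large subset of `X i` contains a `t`-set almost completely joined to
the other `X j`, then there are large pairwise joined subsets of the `X i`. -/
theorem exists_joined [DecidableEq V] {ι : Type*} [Fintype ι] [DecidableEq ι] (X : ι → Finset V)
    {t s E M : ℕ} (hM : 0 < M) (S : Finset ι)
    (h : ∀ i ∈ S, ∀ Y ⊆ X i, M ≤ #Y → ∃ A ⊆ Y, #A = t ∧
      ∀ j ∈ S, j ≠ i → #{v ∈ X j | s < miss G A v} ≤ E)
    (hX : ∀ i ∈ S, Fintype.card ι * E + 2 ^ (Fintype.card ι * t) * M ≤ #(X i)) :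
    ∃ A : ι → Finset V, (∀ i ∈ S, A i ⊆ X i ∧ t ≤ #(A i) + #S * s) ∧ JoinedFam G S A := by
  suffices H : ∀ S' ⊆ S, ∃ A : ι → Finset V, (∀ i ∈ S', A i ⊆ X i ∧ t ≤ #(A i) + #S' * s ∧
      #(A i) ≤ t ∧ ∀ j ∈ S, j ≠ i → #{v ∈ X j | s < miss G (A i) v} ≤ E) ∧ JoinedFam G S' A by
    obtain ⟨A, hA, hJ⟩ := H S subset_rfl
    exact ⟨A, fun i hi => ⟨(hA i hi).1, (hA i hi).2.1⟩, hJ⟩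
  intro S'
  induction S' using Finset.induction_on with
  | empty => exact fun _ => ⟨fun _ => ∅, by simp, fun i hi => by simp at hi⟩
  | insert i S' hi ih =>
  intro hS'
  obtain ⟨A, hA, hJ⟩ := ih ((subset_insert _ _).trans hS')
  have hiS : i ∈ S := hS' (mem_insert_self _ _)
  have hS'S : ∀ j ∈ S', j ∈ S := fun j hj => hS' (mem_insert_of_mem hj)
  have hcard : #S' ≤ Fintype.card ι := card_le_univ _
  set Bad := S'.biUnion fun j => {v ∈ X i | s < miss G (A j) v}
  have hBad : #Bad ≤ Fintype.card ι * E :=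
    (card_biUnion_le_card_mul _ _ E fun j hj =>
      (hA j hj).2.2.2 i hiS (ne_of_mem_of_not_mem hj hi).symm).trans
      (Nat.mul_le_mul_right _ hcard)
  have hY : 2 ^ (#S' * t) * M ≤ #(X i \ Bad) := by
    have h1 := le_card_sdiff Bad (X i)
    have h2 := hX i hiS
    have h3 : 2 ^ (#S' * t) * M ≤ 2 ^ (Fintype.card ι * t) * M :=
      Nat.mul_le_mul_right _ (Nat.pow_le_pow_right (by norm_num) (Nat.mul_le_mul_right _ hcard))
    omega
  obtain ⟨Y', hY', hMY, B, hBA, hJB, hBcard, hBadj⟩ := hJ.exists_shrink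
    (fun j hj => (hA j hj).2.2.1) hY
  obtain ⟨D, hD, hDt, hDE⟩ := h i hiS Y' (hY'.trans sdiff_subset) hMY
  refine ⟨Function.update B i D, fun j hj => ?_, hJB.update hi fun j hj x hx y hy =>
    hBadj j hj x (hD hx) y hy⟩
  rw [card_insert_of_notMem hi]
  rcases mem_insert.1 hj with rfl | hj
  · rw [Function.update_self]
    exact ⟨hD.trans (hY'.trans sdiff_subset), by omega, hDt.le, hDE⟩
  · have hji := ne_of_mem_of_not_mem hj hi
    rw [Function.update_of_ne hji]
    obtain ⟨hAX, ht, ht', hE⟩ := hA j hj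
    refine ⟨(hBA j hj).trans hAX, ?_, (card_le_card (hBA j hj)).trans ht', fun l hl hlj => ?_⟩
    · obtain ⟨y, hy⟩ : Y'.Nonempty := card_pos.1 (hM.trans_le hMY)
      have h1 := hBcard j hj y hy
      have h2 := hits_add_miss G (A j) y
      have h3 : miss G (A j) y ≤ s := by
        by_contra hc
        have := hY' hy
        rw [mem_sdiff] at this
        exact this.2 (mem_biUnion.2 ⟨j, hj, mem_filter.2 ⟨this.1, not_le.1 hc⟩⟩)
      rw [add_mul]
      omega
    · refine le_trans (card_le_card fun v hv => ?_) (hE l hl hlj)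
      rw [mem_filter] at hv ⊢
      exact ⟨hv.1, hv.2.trans_le (miss_mono (hBA j hj) v)⟩

/-- The truncated proportion of non-neighbours of `v` in `A`. -/
noncomputable def wt (G : SimpleGraph V) [DecidableRel G.Adj] (k : ℕ) (A : Finset V) (v : V) : ℝ :=
  ((miss G A v + 1 - k : ℕ) : ℝ) / #A

theorem sum_wt_pow_le [Fintype V] {k n : ℕ}
    (hB : ∀ Q : Finset V, G.IsIndepSet (Q : Set V) → #Q = k → #{v | ∀ q ∈ Q, ¬ G.Adj v q} ≤ n)
    {A : Finset V} (hA : G.IsIndepSet (A : Set V)) (hA0 : 0 < #A) :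
    ∑ v, wt G k A v ^ k ≤ n := by
  have key : ∑ v, (miss G A v).choose k ≤ (#A).choose k * n := by
    have := sum_card_bipartiteAbove_eq_sum_card_bipartiteBelow (s := (univ : Finset V))
      (t := A.powersetCard k) (fun v Q => ∀ q ∈ Q, ¬ G.Adj v q)
    have e : ∀ v, bipartiteAbove (fun v Q => ∀ q ∈ Q, ¬ G.Adj v q) (A.powersetCard k) v
        = powersetCard k {x ∈ A | ¬ G.Adj v x} := by
      intro v
      ext Q
      simp only [bipartiteAbove, mem_filter, mem_powersetCard, subset_iff]
      grind
    simp only [e, card_powersetCard] at this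
    unfold miss
    rw [this, ← card_powersetCard]
    refine sum_le_card_nsmul _ _ _ fun Q hQ => ?_
    rw [mem_powersetCard] at hQ
    exact hB Q (hA.mono (by exact_mod_cast hQ.1)) hQ.2
  have key2 : ∑ v, (miss G A v + 1 - k) ^ k ≤ #A ^ k * n := by
    calc ∑ v, (miss G A v + 1 - k) ^ k ≤ ∑ v, k.factorial * (miss G A v).choose k :=
          sum_le_sum fun v _ => by
            rw [← Nat.descFactorial_eq_factorial_mul_choose]
            exact Nat.pow_sub_le_descFactorial _ _
      _ ≤ k.factorial * ((#A).choose k * n) := by rw [← mul_sum]; exact Nat.mul_le_mul_left _ key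
      _ = (#A).descFactorial k * n := by rw [Nat.descFactorial_eq_factorial_mul_choose, mul_assoc]
      _ ≤ _ := Nat.mul_le_mul_right _ (Nat.descFactorial_le_pow _ _)
  have hpos : (0 : ℝ) < (#A : ℝ) ^ k := by positivity
  simp only [wt, div_pow]
  rw [← sum_div, div_le_iff₀ hpos, mul_comm]
  exact_mod_cast key2

theorem wt_nonneg (k : ℕ) (A : Finset V) (v : V) : 0 ≤ wt G k A v := by
  unfold wt; positivity

theorem le_wt (k : ℕ) (A : Finset V) (v : V) : (miss G A v - k : ℝ) / #A ≤ wt G k A v := by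
  unfold wt
  gcongr
  rw [sub_le_iff_le_add]
  exact_mod_cast (by omega : miss G A v ≤ miss G A v + 1 - k + k)

/-- Bernoulli's inequality for weights. -/
theorem one_sub_le_wt_pow (k : ℕ) (A : Finset V) (v : V) :
    1 - k * (1 - wt G k A v) ≤ wt G k A v ^ k := by
  have := one_add_mul_le_pow (a := wt G k A v - 1) (by linarith [wt_nonneg (G := G) k A v]) k
  rw [add_sub_cancel] at this
  linarith

theorem one_sub_le_wt_pow_of_hits {k h : ℕ} {A : Finset V} {v : V} {ε : ℝ} (hA : 0 < #A)
    (hv : hits G A v ≤ h) (hε : (k : ℝ) * (h + k) ≤ ε * #A) : 1 - ε ≤ wt G k A v ^ k := by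
  refine le_trans ?_ (one_sub_le_wt_pow k A v)
  have h1 := le_wt (G := G) k A v
  have h2 : (hits G A v : ℝ) + miss G A v = #A := by exact_mod_cast hits_add_miss G A v
  have hA' : (0 : ℝ) < #A := by exact_mod_cast hA
  have h3 : (hits G A v : ℝ) ≤ h := by exact_mod_cast hv
  have h4 : 1 - wt G k A v ≤ (h + k) / #A := by
    have : (miss G A v - k : ℝ) / #A = 1 - (hits G A v + k) / #A := by
      rw [eq_sub_iff_add_eq, ← add_div, ← h2, div_eq_one_iff_eq]
      · ring
      · rw [h2]; exact hA'.ne'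
    have h5 : ((hits G A v : ℝ) + k) / #A ≤ (h + k) / #A := by gcongr
    linarith
  have h5 : (k : ℝ) * (1 - wt G k A v) ≤ ε := by
    calc (k : ℝ) * (1 - wt G k A v) ≤ k * ((h + k) / #A) := by gcongr
      _ = k * (h + k) / #A := by ring
      _ ≤ ε := by rwa [div_le_iff₀ hA']
  linarith

theorem le_wt_pow_of_miss {k s q : ℕ} {A : Finset V} {v : V} (hs : 2 * k ≤ s)
    (hA : #A = q * s) (hA0 : 0 < #A) (hv : s < miss G A v) :
    (1 / (2 * q) : ℝ) ^ k ≤ wt G k A v ^ k := by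
  have hs0 : 0 < s := by
    rcases Nat.eq_zero_or_pos s with h | h
    · simp [hA, h] at hA0
    · exact h
  have hq0 : 0 < q := by
    rcases Nat.eq_zero_or_pos q with h | h
    · simp [hA, h] at hA0
    · exact h
  refine pow_le_pow_left₀ (by positivity) (le_trans ?_ (le_wt k A v)) k
  rw [hA]
  have : (2 * k : ℝ) ≤ s := by exact_mod_cast hs
  have : (s : ℝ) ≤ miss G A v := by exact_mod_cast hv.le
  have hs' : (0 : ℝ) < s := by exact_mod_cast hs0
  have hq' : (0 : ℝ) < q := by exact_mod_cast hq0
  rw [div_le_div_iff₀ (by positivity) (by push_cast; positivity)]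
  push_cast
  nlinarith

theorem hits_eq_card {A : Finset V} {v : V} (h : ∀ x ∈ A, G.Adj v x) : hits G A v = #A := by
  unfold hits
  rw [filter_true_of_mem h]

theorem card_le_card_filter_add_sum_miss [DecidableEq V] (W D : Finset V) :
    #W ≤ #{x ∈ W | ∀ u ∈ D, G.Adj u x} + ∑ u ∈ D, miss G W u := by
  have h : W ⊆ {x ∈ W | ∀ u ∈ D, G.Adj u x} ∪ D.biUnion fun u => {x ∈ W | ¬ G.Adj u x} := by
    intro x hx
    simp only [mem_union, mem_filter, mem_biUnion]
    by_cases hc : ∀ u ∈ D, G.Adj u x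
    · exact Or.inl ⟨hx, hc⟩
    · push Not at hc
      obtain ⟨u, hu, hux⟩ := hc
      exact Or.inr ⟨u, hu, hx, hux⟩
  exact (card_le_card h).trans ((card_union_le _ _).trans (Nat.add_le_add_left card_biUnion_le _))

theorem card_le_card_filter_add_sum_hits [DecidableEq V] (W D : Finset V) :
    #W ≤ #{x ∈ W | ∀ u ∈ D, ¬ G.Adj x u} + ∑ u ∈ D, hits G W u := by
  have h : W ⊆ {x ∈ W | ∀ u ∈ D, ¬ G.Adj x u} ∪ D.biUnion fun u => {x ∈ W | G.Adj u x} := by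
    intro x hx
    simp only [mem_union, mem_filter, mem_biUnion]
    by_cases hc : ∀ u ∈ D, ¬ G.Adj x u
    · exact Or.inl ⟨hx, hc⟩
    · push Not at hc
      obtain ⟨u, hu, hux⟩ := hc
      exact Or.inr ⟨u, hu, hx, hux.symm⟩
  exact (card_le_card h).trans ((card_union_le _ _).trans (Nat.add_le_add_left card_biUnion_le _))

theorem le_sum_wt {k : ℕ} {A W : Finset V} {t : ℕ} (hA : #A = t) (ht : 0 < t) {δ : ℝ}
    (hk : (k : ℝ) ≤ δ * t) {x : ℝ} (hx : ∀ u ∈ A, x ≤ miss G W u) :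
    x - δ * #W ≤ ∑ v ∈ W, wt G k A v := by
  have ht' : (0 : ℝ) < t := by exact_mod_cast ht
  have h1 : (∑ v ∈ W, (miss G A v : ℝ)) = ∑ u ∈ A, (miss G W u : ℝ) := by
    exact_mod_cast sum_miss_comm G A W
  have h2 : t * x ≤ ∑ u ∈ A, (miss G W u : ℝ) := by
    rw [← hA, ← nsmul_eq_mul]
    exact card_nsmul_le_sum _ _ _ hx
  have h3 : ∑ v ∈ W, (miss G A v - k : ℝ) / #A ≤ ∑ v ∈ W, wt G k A v :=
    sum_le_sum fun v _ => le_wt k A v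
  refine le_trans ?_ h3
  rw [← sum_div, sum_sub_distrib, h1, sum_const, nsmul_eq_mul, hA, le_div_iff₀ ht']
  have h4 : (#W : ℝ) * k ≤ #W * (δ * t) := by gcongr
  nlinarith

/-- What the absence of a book in the complement and of a multipartite graph in `G` provides:
few common non-neighbours of independent `k`-sets, no vertex with `β` neighbours in every member
of a joined family, and independent sets in every set of `M` vertices. -/
structure Locality [Fintype V] (G : SimpleGraph V) [DecidableRel G.Adj] (ι : Type*) [Fintype ι]
    (k n β T M : ℕ) : Prop where
  book : ∀ Q : Finset V, G.IsIndepSet (Q : Set V) → #Q = k → #{v | ∀ q ∈ Q, ¬ G.Adj v q} < n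
  free : ∀ (v : V) (A : ι → Finset V), JoinedFam G univ A → ¬ ∀ i, β ≤ hits G (A i) v
  indep : ∀ (Y : Finset V) (τ : ℕ), M ≤ #Y → τ ≤ T →
    ∃ A ⊆ Y, #A = τ ∧ G.IsIndepSet (A : Set V)

variable [Fintype V] [DecidableEq V] {ι : Type*} [Fintype ι] [DecidableEq ι]
  {k n β T M r : ℕ} {ε : ℝ}

omit [DecidableEq V] [DecidableEq ι] in
theorem Locality.sum_wt_pow_le (H : Locality G ι k n β T M) {A : Finset V}
    (hA : G.IsIndepSet (A : Set V)) (hA0 : 0 < #A) : ∑ v, wt G k A v ^ k ≤ n :=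
  _root_.sum_wt_pow_le (fun Q hQ hk => (H.book Q hQ hk).le) hA hA0

omit [DecidableEq V] [DecidableEq ι] in
theorem Locality.card_le_of_wt (H : Locality G ι k n β T M) {A : Finset V}
    (hA : G.IsIndepSet (A : Set V)) (hA0 : 0 < #A) {D : Finset V} (hε : 0 < ε) (hε2 : ε ≤ 1 / 2)
    (hD : ∀ v ∈ D, 1 - ε ≤ wt G k A v ^ k) : (#D : ℝ) ≤ (1 + 2 * ε) * n := by
  have h1 := H.sum_wt_pow_le hA hA0
  have h2 : (#D : ℝ) * (1 - ε) ≤ ∑ v, wt G k A v ^ k := by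
    rw [← nsmul_eq_mul]
    exact (card_nsmul_le_sum _ _ _ hD).trans
      (sum_le_sum_of_subset_of_nonneg (subset_univ _)
        fun v _ _ => pow_nonneg (wt_nonneg k A v) k)
  have h3 : (0 : ℝ) ≤ #D := by positivity
  have h4 : (0 : ℝ) ≤ n := by positivity
  have h5 : (1 : ℝ) ≤ (1 - ε) * (1 + 2 * ε) := by nlinarith
  calc (#D : ℝ) ≤ #D * ((1 - ε) * (1 + 2 * ε)) := le_mul_of_one_le_right h3 h5
    _ = (#D * (1 - ε)) * (1 + 2 * ε) := by ring
    _ ≤ n * (1 + 2 * ε) := by gcongr; exact h2.trans h1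
    _ = _ := by ring

/-- There is a joined family of independent `t`-sets indexed by `ι`. -/
theorem Locality.exists_system (H : Locality G ι k n β T M) (hM : 0 < M)
    (hr : Fintype.card ι = r) (hN : r * n ≤ Fintype.card V + r) {L t : ℕ} (ht : 0 < t)
    (hL : 0 < L)
    (hε : 0 < ε) (hεr : 8 * r * ε ≤ 1) (hkL : 2 * k ≤ ε * L) (hkt : 2 * (k * k) ≤ ε * t)
    (hT : L ^ r * t ≤ T) (hn : 2 * (2 ^ (r * T) * M) ≤ n) (hnr : 4 * r ≤ n) :
    ∃ A : ι → Finset V, JoinedFam G univ A ∧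
      ∀ i, #(A i) = t ∧ G.IsIndepSet (A i : Set V) := by
  suffices h : ∀ S : Finset ι, ∃ A : ι → Finset V, JoinedFam G S A ∧
      ∀ i ∈ S, #(A i) = L ^ (r - #S) * t ∧ G.IsIndepSet (A i : Set V) by
    obtain ⟨A, hA, hA'⟩ := h univ
    refine ⟨A, hA, fun i => ?_⟩
    have := hA' i (mem_univ i)
    rwa [card_univ, hr, Nat.sub_self, pow_zero, one_mul] at this
  intro S
  induction S using Finset.induction_on with
  | empty => exact ⟨fun _ => ∅, fun i hi => by simp at hi, by simp⟩
  | insert i S hi ih =>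
  obtain ⟨A, hJ, hA⟩ := ih
  have hcard : #S + 1 ≤ r := by
    rw [← hr, ← card_insert_of_notMem hi]; exact card_le_univ _
  have hr0 : (1 : ℝ) ≤ r := by exact_mod_cast (by omega : 1 ≤ r)
  set τ := L ^ (r - (#S + 1)) * t with hτ
  have hτA : L ^ (r - #S) * t = L * τ := by
    rw [hτ, ← mul_assoc, ← pow_succ', show r - (#S + 1) + 1 = r - #S by omega]
  have hτT : L * τ ≤ T := by
    rw [← hτA]
    exact (Nat.mul_le_mul_right _ (Nat.pow_le_pow_right hL (Nat.sub_le _ _))).trans hT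
  have htτ : t ≤ τ := Nat.le_mul_of_pos_left _ (by positivity)
  have hLτ : τ ≤ L * τ := Nat.le_mul_of_pos_left _ hL
  set D : ι → Finset V := fun j => {v | hits G (A j) v < τ}
  have hD : ∀ j ∈ S, (#(D j) : ℝ) ≤ (1 + 2 * ε) * n := by
    intro j hj
    have hAj : #(A j) = L * τ := (hA j hj).1.trans hτA
    have hAj0 : 0 < #(A j) := by rw [hAj]; omega
    refine H.card_le_of_wt (hA j hj).2 hAj0 hε (by nlinarith) fun v hv =>
      one_sub_le_wt_pow_of_hits hAj0 (mem_filter.1 hv).2.le ?_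
    rw [hAj]
    have h1 : (t : ℝ) ≤ L * τ := by exact_mod_cast htτ.trans hLτ
    have h2 : 2 * (k * k) ≤ ε * (L * τ) := hkt.trans (by gcongr)
    have h3 : 2 * k * (τ : ℝ) ≤ ε * L * τ := by gcongr
    push_cast
    nlinarith
  have hDS : (#(S.biUnion D) : ℝ) ≤ (r - 1) * ((1 + 2 * ε) * n) := by
    calc (#(S.biUnion D) : ℝ) ≤ ∑ j ∈ S, (#(D j) : ℝ) := by exact_mod_cast card_biUnion_le
      _ ≤ #S * ((1 + 2 * ε) * n) := by rw [← nsmul_eq_mul]; exact sum_le_card_nsmul _ _ _ hD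
      _ ≤ _ := by
        gcongr
        rw [le_sub_iff_add_le]
        exact_mod_cast hcard
  have hN' : (r * n : ℝ) ≤ Fintype.card V + r := by exact_mod_cast hN
  have hnr' : (4 * r : ℝ) ≤ n := by exact_mod_cast hnr
  have hY : 2 ^ (#S * (L * τ)) * M ≤ #(univ \ S.biUnion D) := by
    have h1 : 2 ^ (#S * (L * τ)) * M ≤ 2 ^ (r * T) * M :=
      Nat.mul_le_mul_right _ (Nat.pow_le_pow_right (by norm_num)
        (Nat.mul_le_mul (by omega) hτT))
    have h2 : (Fintype.card V : ℝ) ≤ #(univ \ S.biUnion D) + #(S.biUnion D) := by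
      have := le_card_sdiff (S.biUnion D) univ
      rw [card_univ] at this
      exact_mod_cast (by omega : Fintype.card V ≤ #(univ \ S.biUnion D) + #(S.biUnion D))
    have h3 : (n : ℝ) ≤ 2 * #(univ \ S.biUnion D) := by
      have hn0 : (0 : ℝ) ≤ n := by positivity
      have e1 : 8 * r * ε * n ≤ 1 * n := by gcongr
      have e2 : 0 ≤ ε * n := by positivity
      nlinarith
    have h4 : n ≤ 2 * #(univ \ S.biUnion D) := by exact_mod_cast h3
    omega
  obtain ⟨Y', hY', hMY, B, hBA, hJB, hBcard, hBadj⟩ := hJ.exists_shrink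
    (fun j hj => ((hA j hj).1.trans hτA).le) hY
  have hB : ∀ j, ∃ C, j ∈ S → C ⊆ B j ∧ #C = τ := by
    intro j
    by_cases hj : j ∈ S
    · obtain ⟨y, hy⟩ : Y'.Nonempty := card_pos.1 (hM.trans_le hMY)
      have h1 : τ ≤ #(B j) := by
        rw [hBcard j hj y hy]
        by_contra hc
        exact (mem_sdiff.1 (hY' hy)).2 (mem_biUnion.2 ⟨j, hj, by
          simpa [D] using hc⟩)
      obtain ⟨C, hC, hC'⟩ := exists_subset_card_eq h1
      exact ⟨C, fun _ => ⟨hC, hC'⟩⟩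
    · exact ⟨∅, fun h => absurd h hj⟩
  choose C hC using hB
  obtain ⟨I, hI, hIτ, hIi⟩ := H.indep Y' τ hMY (hLτ.trans hτT)
  refine ⟨Function.update C i I, (hJB.mono fun j hj => (hC j hj).1).update hi
    fun j hj x hx y hy => hBadj j hj x (hI hx) y ((hC j hj).1 hy), fun j hj => ?_⟩
  rw [card_insert_of_notMem hi]
  rcases mem_insert.1 hj with rfl | hj
  · rw [Function.update_self]
    exact ⟨hIτ, hIi⟩
  · rw [Function.update_of_ne (ne_of_mem_of_not_mem hj hi)]
    exact ⟨(hC j hj).2, (hA j hj).2.mono (by exact_mod_cast (hC j hj).1.trans (hBA j hj))⟩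

/-- Stability: almost all vertices are partitioned into sets `W i` of size about `n`, such that
every large subset of `W i` contains a `t`-set almost completely joined to the other `W j`. -/
theorem Locality.exists_cores (H : Locality G ι k n β T M) (hM : 0 < M)
    (hr : Fintype.card ι = r) (hr0 : 0 < r) (hN : r * n ≤ Fintype.card V + r) {t s q : ℕ}
    {θ : ℝ}
    (hε : 0 < ε) (hεr : 8 * r * ε ≤ 1) (htq : t = q * s) (hq : 4 ≤ q) (hks : 2 * k ≤ s)
    (hβs : β ≤ s) (hs : 0 < s) (hβ : k * (β + k) ≤ ε * t) (hθ : θ = (1 / (2 * q)) ^ k)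
    (htT : t ≤ T) (hnε : 1 ≤ ε * n)
    {A : ι → Finset V} (hJ : JoinedFam G univ A)
    (hA : ∀ i, #(A i) = t ∧ G.IsIndepSet (A i : Set V)) :
    ∃ W : ι → Finset V, (∀ i, (#(W i) : ℝ) ≤ 2 * n ∧ (1 - 5 * r * ε / θ) * n ≤ #(W i)) ∧
      (∀ i j, i ≠ j → Disjoint (W i) (W j)) ∧
      ∀ i, ∀ X ⊆ W i, 2 ^ (r * t) * M ≤ #X → ∃ B ⊆ X, #B = t ∧
        ∀ j, j ≠ i → (#{v ∈ W j | s < miss G B v} : ℝ) ≤ 6 * r * ε / θ ^ 2 * n := by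
  have hts : 4 * s ≤ t := htq ▸ Nat.mul_le_mul_right _ hq
  have ht0 : 0 < t := by omega
  have hr1 : (1 : ℝ) ≤ r := by exact_mod_cast hr0
  have hn0 : (0 : ℝ) ≤ n := by positivity
  have hq0 : (4 : ℝ) ≤ q := by exact_mod_cast hq
  have hθ0 : 0 < θ := by rw [hθ]; positivity
  have hθ1 : θ ≤ 1 := by
    rw [hθ]
    refine pow_le_one₀ (by positivity) ?_
    rw [div_le_one (by positivity)]; linarith
  have hwt : ∀ (B : Finset V) (v : V), #B = t → hits G B v < β → 1 - ε ≤ wt G k B v ^ k :=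
    fun B v hB hv => one_sub_le_wt_pow_of_hits (by omega) hv.le (by rw [hB]; exact hβ)
  have hwt' : ∀ (B : Finset V) (v : V), #B = t → s < miss G B v → θ ≤ wt G k B v ^ k :=
    fun B v hB hv => hθ ▸ le_wt_pow_of_miss hks (hB.trans htq) (by omega) hv
  have hnn : ∀ (B : Finset V) (v : V), 0 ≤ wt G k B v ^ k :=
    fun B v => pow_nonneg (wt_nonneg k B v) k
  have hdis : ∀ i v, ¬ (hits G (A i) v < β ∧ miss G (A i) v ≤ s) := by
    rintro i v ⟨h1, h2⟩
    have h3 := hits_add_miss G (A i) v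
    have h4 := (hA i).1
    omega
  set W : ι → Finset V := fun i => {v | hits G (A i) v < β ∧ ∀ j, j ≠ i → miss G (A j) v ≤ s}
    with hW
  have hWup : ∀ i, (#(W i) : ℝ) ≤ (1 + 2 * ε) * n := fun i =>
    H.card_le_of_wt (hA i).2 (by rw [(hA i).1]; exact ht0) hε (by nlinarith) fun v hv =>
      hwt _ _ (hA i).1 (mem_filter.1 hv).2.1
  set R := univ \ univ.biUnion W
  have hR : (#R : ℝ) * θ ≤ 2 * r * ε * n := by
    have h1 : ∀ v, (1 - ε) + (if v ∈ R then θ else 0) ≤ ∑ i, wt G k (A i) v ^ k := by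
      intro v
      obtain ⟨i, hi⟩ := not_forall.1 (H.free v A hJ)
      rw [not_le] at hi
      split_ifs with hv
      · have hvW : v ∉ W i := fun h => (mem_sdiff.1 hv).2 (mem_biUnion.2 ⟨i, mem_univ _, h⟩)
        obtain ⟨j, hji, hj⟩ : ∃ j, j ≠ i ∧ s < miss G (A j) v := by
          by_contra! hc
          exact hvW (mem_filter.2 ⟨mem_univ _, hi, hc⟩)
        rw [← add_sum_erase _ _ (mem_univ i)]
        refine add_le_add (hwt _ _ (hA i).1 hi) ((hwt' _ _ (hA j).1 hj).trans ?_)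
        exact single_le_sum (f := fun l => wt G k (A l) v ^ k) (fun l _ => hnn _ _)
          (mem_erase.2 ⟨hji, mem_univ j⟩)
      · rw [add_zero]
        exact (hwt _ _ (hA i).1 hi).trans
          (single_le_sum (f := fun l => wt G k (A l) v ^ k) (fun l _ => hnn _ _) (mem_univ i))
    have h2 : ∑ v : V, ((1 - ε) + (if v ∈ R then θ else 0)) ≤ r * n := by
      refine (sum_le_sum fun v _ => h1 v).trans ?_
      rw [sum_comm, ← hr, ← card_univ, ← nsmul_eq_mul]
      exact sum_le_card_nsmul _ _ _ fun i _ =>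
        H.sum_wt_pow_le (hA i).2 (by rw [(hA i).1]; exact ht0)
    rw [sum_add_distrib, sum_ite_mem, sum_const, sum_const, univ_inter, card_univ, nsmul_eq_mul,
      nsmul_eq_mul] at h2
    have hN' : (r * n : ℝ) ≤ Fintype.card V + r := by exact_mod_cast hN
    have e1 : (r * n - r : ℝ) * (1 - ε) ≤ Fintype.card V * (1 - ε) :=
      mul_le_mul_of_nonneg_right (by linarith) (by nlinarith)
    have e2 : (r : ℝ) * 1 ≤ r * (ε * n) := by gcongr
    have e3 : 0 ≤ r * ε := by positivity
    nlinarith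
  have hWlow : ∀ i, (1 - 5 * r * ε / θ) * n ≤ #(W i) := by
    intro i
    have h1 : (Fintype.card V : ℝ) ≤ #R + ∑ j, (#(W j) : ℝ) := by
      have e1 : #univ - #(univ.biUnion W) ≤ #R := le_card_sdiff _ _
      have e2 : #(univ.biUnion W) ≤ ∑ j, #(W j) := card_biUnion_le
      rw [card_univ] at e1
      exact_mod_cast (by omega : Fintype.card V ≤ #R + ∑ j, #(W j))
    have h2 : ∑ j ∈ univ.erase i, (#(W j) : ℝ) ≤ (r - 1) * ((1 + 2 * ε) * n) := by
      refine (sum_le_card_nsmul _ _ _ fun j _ => hWup j).trans ?_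
      rw [card_erase_of_mem (mem_univ i), card_univ, hr, nsmul_eq_mul, Nat.cast_sub hr0,
        Nat.cast_one]
    rw [← add_sum_erase _ _ (mem_univ i)] at h1
    have hN' : (r * n : ℝ) ≤ Fintype.card V + r := by exact_mod_cast hN
    have h3 : (#R : ℝ) ≤ 2 * r * ε * n / θ := by rwa [le_div_iff₀ hθ0]
    have h4 : 3 * r * ε * n ≤ 3 * r * ε * n / θ := le_div_self (by positivity) hθ0 hθ1
    have h5 : (1 - 5 * r * ε / θ) * n = n - 2 * r * ε * n / θ - 3 * r * ε * n / θ := by ring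
    rw [h5]
    have e2 : 0 ≤ ε * n := by positivity
    nlinarith
  refine ⟨W, fun i => ⟨(hWup i).trans (by nlinarith), hWlow i⟩, ?_, ?_⟩
  · intro i j hij
    rw [Finset.disjoint_left]
    intro v hi hj
    exact hdis i v ⟨(mem_filter.1 hi).2.1, (mem_filter.1 hj).2.2 i hij⟩
  · intro i X hX hcX
    obtain ⟨Y', hY', hMY, B, hBA, hJB, hBcard, hBadj⟩ :=
      (show JoinedFam G (univ.erase i) A from
        fun a _ b _ => hJ a (mem_univ a) b (mem_univ b)).exists_shrink
      (Y := X) (m := M) (u := t) (fun j _ => (hA j).1.le) (le_trans (Nat.mul_le_mul_right _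
        (Nat.pow_le_pow_right (by norm_num) (Nat.mul_le_mul_right _
          (by rw [← hr]; exact card_le_univ _)))) hcX)
    obtain ⟨I, hI, hIt, hIi⟩ := H.indep Y' t hMY htT
    refine ⟨I, hI.trans hY', hIt, fun j hji => ?_⟩
    obtain ⟨y, hy⟩ : Y'.Nonempty := card_pos.1 (hM.trans_le hMY)
    have hJI : JoinedFam G univ (Function.update B i I) := by
      have := hJB.update (i := i) (D := I) (by simp) fun l hl x hx z hz =>
        hBadj l hl x (hI hx) z hz
      rwa [insert_erase (mem_univ i)] at this
    have hWI : ∀ v ∈ W i, 1 - ε ≤ wt G k I v ^ k := by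
      intro v hv
      refine hwt _ _ hIt (not_le.1 fun hc => H.free v _ hJI fun l => ?_)
      by_cases hl : l = i
      · subst hl
        rwa [Function.update_self]
      · rw [Function.update_of_ne hl]
        have hl' : l ∈ univ.erase i := mem_erase.2 ⟨hl, mem_univ l⟩
        have e1 := hBcard l hl' y hy
        have e2 := hits_add_miss G (A l) y
        have e3 := (hA l).1
        have e4 := (mem_filter.1 (hX (hY' hy))).2.2 l hl
        have e5 := (mem_filter.1 hv).2.2 l hl
        have e6 := miss_mono (G := G) (hBA l hl') v
        have e7 := hits_add_miss G (B l) v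
        omega
    set D : Finset V := {v ∈ W j | s < miss G I v}
    have hdisj : Disjoint (W i) D := by
      rw [Finset.disjoint_left]
      intro v hi hj
      exact hdis i v ⟨(mem_filter.1 hi).2.1,
        (mem_filter.1 (mem_filter.1 hj).1).2.2 i (Ne.symm hji)⟩
    have h1 : (#(W i) : ℝ) * (1 - ε) + #D * θ ≤ n := by
      refine le_trans ?_ (H.sum_wt_pow_le hIi (by omega))
      refine le_trans ?_ (sum_le_sum_of_subset_of_nonneg (subset_univ (W i ∪ D))
        fun v _ _ => hnn _ _)
      rw [sum_union hdisj, ← nsmul_eq_mul, ← nsmul_eq_mul]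
      exact add_le_add (card_nsmul_le_sum _ _ _ hWI)
        (card_nsmul_le_sum _ _ _ fun v hv => hwt' _ _ hIt (mem_filter.1 hv).2)
    have h2 := hWlow i
    have h3 : ε ≤ r * ε / θ := by
      rw [le_div_iff₀ hθ0]
      nlinarith
    have h4 : (#D : ℝ) * θ ≤ 6 * r * ε / θ * n := by
      have e1 : (1 - 5 * r * ε / θ) * n * (1 - ε) ≤ #(W i) * (1 - ε) :=
        mul_le_mul_of_nonneg_right h2 (by nlinarith)
      have e2 : ε * n ≤ r * ε / θ * n := by gcongr
      have e3 : 0 ≤ 5 * r * ε / θ * n * ε := by positivity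
      have e4 : 6 * r * ε / θ * n = 5 * r * ε / θ * n + r * ε / θ * n := by ring
      rw [e4]
      nlinarith
    calc (#D : ℝ) = #D * θ / θ := by field_simp
      _ ≤ 6 * r * ε / θ * n / θ := by gcongr
      _ = _ := by field_simp

omit [DecidableEq ι] in
/-- Two disjoint sets of vertices cannot be too sparsely joined to an independent set `A`, one
of them being almost completely non-adjacent to `A`. -/
theorem Locality.not_sparse (H : Locality G ι k n β T M) (hk : 0 < k) {A W W' : Finset V} {t : ℕ}
    (hA : #A = t) (hAi : G.IsIndepSet (A : Set V)) (ht : 0 < t) (hn : 0 < n)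
    (hkt : (k : ℝ) * k ≤ ε * t) {c γ : ℝ} (hc : 0 < c) (hγ : 0 < γ) (hγc : 4 * k * γ ≤ c ^ k)
    (hεc : ε ≤ c) (hε : 0 < ε) (hεγ : ε ≤ γ) (hWW' : Disjoint W W') (hW1 : (1 - γ / 2) * n ≤ #W)
    (hW2 : (#W : ℝ) ≤ 2 * n) (hW' : (#W' : ℝ) ≤ 2 * n)
    (hAW : ∀ u ∈ A, (#W : ℝ) - γ * n ≤ miss G W u)
    (hAW' : ∀ u ∈ A, 8 * c * n ≤ miss G W' u) : False := by
  have hk1 : (1 : ℝ) ≤ k := by exact_mod_cast hk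
  have ht' : (0 : ℝ) < t := by exact_mod_cast ht
  have hn' : (0 : ℝ) < n := by exact_mod_cast hn
  have h1 := le_sum_wt (G := G) (k := k) hA ht (δ := ε / k) (by
    rw [div_mul_eq_mul_div, le_div_iff₀ (by positivity)]; exact hkt) hAW
  have h2 := le_sum_wt (G := G) (k := k) hA ht (δ := ε) (by nlinarith) hAW'
  have h3 : (1 - γ / 2 - 2 * ε - k * γ) * n ≤ ∑ v ∈ W, wt G k A v ^ k := by
    have e1 : ∑ v ∈ W, (1 - k * (1 - wt G k A v)) ≤ ∑ v ∈ W, wt G k A v ^ k :=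
      sum_le_sum fun v _ => one_sub_le_wt_pow k A v
    rw [sum_sub_distrib, ← mul_sum, sum_sub_distrib, sum_const, nsmul_eq_mul] at e1
    have e2 : k * ((#W : ℝ) - γ * n - ε / k * #W) ≤ k * ∑ v ∈ W, wt G k A v := by gcongr
    have e3 : k * ((#W : ℝ) - γ * n - ε / k * #W) = k * #W - k * γ * n - ε * #W := by
      field_simp
    have e4 : ε * #W ≤ ε * (2 * n) := by gcongr
    nlinarith
  have h4 : 4 * c ^ k * n ≤ ∑ v ∈ W', wt G k A v ^ k := by
    obtain ⟨l, rfl⟩ : ∃ l, k = l + 1 := ⟨k - 1, by omega⟩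
    have e1 : ∑ v ∈ W', c ^ l * (wt G (l + 1) A v - c) ≤ ∑ v ∈ W', wt G (l + 1) A v ^ (l + 1) := by
      refine sum_le_sum fun v _ => ?_
      have hw := wt_nonneg (G := G) (l + 1) A v
      rcases le_total (wt G (l + 1) A v) c with h | h
      · exact (mul_nonpos_of_nonneg_of_nonpos (by positivity) (by linarith)).trans (by positivity)
      · rw [pow_succ]
        exact mul_le_mul (pow_le_pow_left₀ hc.le h _) (by linarith) (by linarith) (by positivity)
    refine le_trans ?_ e1
    rw [← mul_sum, sum_sub_distrib, sum_const, nsmul_eq_mul, pow_succ]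
    have e2 : 4 * c * n ≤ ∑ v ∈ W', wt G (l + 1) A v - #W' * c := by
      have : ε * #W' ≤ c * (2 * n) := by gcongr
      have : #W' * c ≤ 2 * n * c := by gcongr
      linarith
    calc 4 * (c ^ l * c) * n = c ^ l * (4 * c * n) := by ring
      _ ≤ _ := by gcongr
  have h5 : ∑ v ∈ W, wt G k A v ^ k + ∑ v ∈ W', wt G k A v ^ k ≤ n := by
    rw [← sum_union hWW']
    exact (sum_le_sum_of_subset_of_nonneg (subset_univ _)
      fun v _ _ => pow_nonneg (wt_nonneg k A v) k).trans (H.sum_wt_pow_le hAi (by omega))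
  have h6 : γ ≤ k * γ := le_mul_of_one_le_left hγ.le hk1
  have h7 : (0 : ℝ) < (4 * c ^ k - γ / 2 - 2 * ε - k * γ) * n :=
    mul_pos (by linarith) hn'
  linarith

/-- All but few vertices are partitioned into classes of small maximum degree. -/
theorem Locality.exists_classes (H : Locality G ι k n β T M) (hM : 0 < M)
    (hr : Fintype.card ι = r) (hr0 : 0 < r) {t s q a : ℕ} (hk : 0 < k) (hn : 0 < n)
    {θ c γ : ℝ} (hε : 0 < ε) (htq : t = q * s) (hq : r + 1 ≤ q) (hβs : β ≤ s) (hs : 0 < s)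
    (hkt : (k : ℝ) * k ≤ ε * t) (htT : t ≤ T) (hθ0 : 0 < θ) (hθ1 : θ ≤ 1)
    (hc : 0 < c) (hca : (a + 1) * (8 * c) ≤ 1 / 4) (hγ : 0 < γ) (hγ1 : γ ≤ 1 / 4)
    (hγc : 4 * k * γ ≤ c ^ k) (hεc : ε ≤ c) (hεγ : 12 * r ^ 2 * ε ≤ γ * θ ^ 2)
    (hnM : 2 * (2 ^ (r * t) * (2 ^ (r * t) * M) : ℕ) ≤ γ * n)
    (star : ∀ (v : V) (i : ι) (F : ι → Finset V), JoinedFam G univ F →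
      (∀ j, ∀ x ∈ F j, G.Adj v x) → a ≤ #(F i) → ¬ ∀ j, j ≠ i → β ≤ #(F j))
    {W : ι → Finset V}
    (hW : ∀ i, (#(W i) : ℝ) ≤ 2 * n ∧ (1 - 5 * r * ε / θ) * n ≤ #(W i))
    (hWdisj : ∀ i j, i ≠ j → Disjoint (W i) (W j))
    (hWE : ∀ i, ∀ X ⊆ W i, 2 ^ (r * t) * M ≤ #X → ∃ B ⊆ X, #B = t ∧
        ∀ j, j ≠ i → (#{v ∈ W j | s < miss G B v} : ℝ) ≤ 6 * r * ε / θ ^ 2 * n) :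
    ∃ U : ι → Finset V, (∀ i j, i ≠ j → Disjoint (U i) (U j)) ∧
      (∀ i, ∀ v ∈ U i, hits G (U i) v < a) ∧ #(univ \ univ.biUnion U) ≤ r ^ 2 * M := by
  have hr1 : (1 : ℝ) ≤ r := by exact_mod_cast hr0
  have hn' : (0 : ℝ) < n := by exact_mod_cast hn
  have ht0 : 0 < t := htq ▸ Nat.mul_pos (by omega) hs
  have hε6 : 6 * r * ε / θ ^ 2 ≤ γ / (2 * r) := by
    rw [div_le_div_iff₀ (by positivity) (by positivity)]
    nlinarith
  have hε5 : 5 * r * ε / θ ≤ γ / 2 := by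
    rw [div_le_div_iff₀ hθ0 (by norm_num)]
    have e1 : γ * θ ^ 2 ≤ γ * θ := by
      gcongr
      nlinarith
    have e2 : r * ε ≤ r ^ 2 * ε := by
      gcongr
      nlinarith
    nlinarith
  have hεγ' : ε ≤ γ := by
    have e1 : γ * θ ^ 2 ≤ γ := mul_le_of_le_one_right hγ.le (pow_le_one₀ hθ0.le hθ1)
    have e2 : (1 : ℝ) ≤ r ^ 2 := one_le_pow₀ hr1
    nlinarith
  have hWlow : ∀ i, (1 - γ / 2) * n ≤ #(W i) := fun i =>
    le_trans (by gcongr) (hW i).2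
  have embed : ∀ (S : Finset ι) (X : ι → Finset V), (∀ i ∈ S, X i ⊆ W i ∧ γ * n ≤ #(X i)) →
      ∃ A : ι → Finset V, (∀ i ∈ S, A i ⊆ X i ∧ β ≤ #(A i)) ∧ JoinedFam G S A := by
    intro S X hX
    have hE : (⌊γ / (2 * r) * n⌋₊ : ℝ) ≤ γ / (2 * r) * n := Nat.floor_le (by positivity)
    obtain ⟨A, hA, hJ⟩ := exists_joined (G := G) X (t := t) (s := s)
      (E := ⌊γ / (2 * r) * n⌋₊) (M := 2 ^ (r * t) * M) (by positivity) S
      (fun i hi Y hY hMY => by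
        obtain ⟨B, hB, hBt, hBE⟩ := hWE i Y (hY.trans (hX i hi).1) hMY
        refine ⟨B, hB, hBt, fun j hj hji => Nat.le_floor ?_⟩
        refine le_trans ?_ ((hBE j hji).trans (mul_le_mul_of_nonneg_right hε6 hn'.le))
        exact_mod_cast card_le_card (filter_subset_filter _ (hX j hj).1))
      (fun i hi => by
        rw [hr]
        have e1 : (r : ℝ) * ⌊γ / (2 * r) * n⌋₊ ≤ γ * n / 2 := by
          calc (r : ℝ) * ⌊γ / (2 * r) * n⌋₊ ≤ r * (γ / (2 * r) * n) := by gcongr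
            _ = _ := by field_simp
        have e2 := (hX i hi).2
        have e3 : (r : ℝ) * ⌊γ / (2 * r) * n⌋₊ + (2 ^ (r * t) * (2 ^ (r * t) * M) : ℕ)
            ≤ #(X i) := by linarith
        exact_mod_cast e3)
    refine ⟨A, fun i hi => ⟨(hA i hi).1, ?_⟩, hJ⟩
    have e1 := (hA i hi).2
    have e2 : #S ≤ r := hr ▸ card_le_univ S
    have e3 : #S * s ≤ r * s := Nat.mul_le_mul_right _ e2
    have e4 : (r + 1) * s ≤ q * s := Nat.mul_le_mul_right _ hq
    rw [add_mul, one_mul] at e4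
    omega
  have hcol : ∀ v, ∃ i, (hits G (W i) v : ℝ) < γ * n := by
    intro v
    by_contra! hc
    obtain ⟨A, hA, hJ⟩ := embed univ (fun i => {x ∈ W i | G.Adj v x})
      fun i _ => ⟨filter_subset _ _, hc i⟩
    refine H.free v A hJ fun i => ?_
    rw [hits_eq_card fun x hx => (mem_filter.1 ((hA i (mem_univ i)).1 hx)).2]
    exact (hA i (mem_univ i)).2
  choose col hcol using hcol
  set U : ι → Finset V := fun i =>
    {v | col v = i ∧ ∀ j, j ≠ i → (miss G (W j) v : ℝ) ≤ 8 * c * n}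
  refine ⟨U, fun i j hij => ?_, fun i v hv => ?_, ?_⟩
  · rw [Finset.disjoint_left]
    intro v hi hj
    exact hij ((mem_filter.1 hi).2.1.symm.trans (mem_filter.1 hj).2.1)
  · by_contra! hd
    obtain ⟨D, hD, hDa⟩ := exists_subset_card_eq hd
    obtain ⟨A, hA, hJ⟩ := embed (univ.erase i)
      (fun j => {x ∈ W j | ∀ u ∈ insert v D, G.Adj u x}) fun j hj => by
        refine ⟨filter_subset _ _, ?_⟩
        have e1 : #(W j) ≤ #{x ∈ W j | ∀ u ∈ insert v D, G.Adj u x} +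
            ∑ u ∈ insert v D, miss G (W j) u := by
          convert card_le_card_filter_add_sum_miss (G := G) (W j) (insert v D)
        have e2 : (∑ u ∈ insert v D, (miss G (W j) u : ℝ)) ≤ (a + 1) * (8 * c * n) := by
          calc _ ≤ (#(insert v D) : ℝ) * (8 * c * n) := by
                rw [← nsmul_eq_mul]
                refine sum_le_card_nsmul _ _ _ fun u hu => ?_
                have hu' : u ∈ U i := by
                  rcases mem_insert.1 hu with rfl | hu
                  · exact hv
                  · exact (mem_filter.1 (hD hu)).1
                exact (mem_filter.1 hu').2.2 j (ne_of_mem_erase hj)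
            _ ≤ _ := by
              gcongr
              exact_mod_cast hDa ▸ card_insert_le v D
        have e3 := hWlow j
        have e4 := (Nat.cast_le (α := ℝ)).2 e1
        push_cast at e4
        nlinarith
    have hAD : ∀ j ∈ univ.erase i, ∀ u ∈ insert v D, ∀ y ∈ A j, G.Adj u y :=
      fun j hj u hu y hy => (mem_filter.1 ((hA j hj).1 hy)).2 u hu
    have hJ' : JoinedFam G univ (Function.update A i D) := by
      have := hJ.update (i := i) (D := D) (by simp) fun j hj x hx y hy =>
        hAD j hj x (mem_insert_of_mem hx) y hy
      rwa [insert_erase (mem_univ i)] at this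
    refine star v i _ hJ' (fun j x hx => ?_) (by rw [Function.update_self, hDa]) fun j hj => ?_
    · by_cases hj : j = i
      · subst hj
        rw [Function.update_self] at hx
        exact (mem_filter.1 (hD hx)).2
      · rw [Function.update_of_ne hj] at hx
        exact hAD j (mem_erase.2 ⟨hj, mem_univ j⟩) v (mem_insert_self _ _) x hx
    · rw [Function.update_of_ne hj]
      exact (hA j (mem_erase.2 ⟨hj, mem_univ j⟩)).2
  · set B : ι × ι → Finset V := fun p =>
      {v | col v = p.1 ∧ p.2 ≠ p.1 ∧ 8 * c * n < (miss G (W p.2) v : ℝ)}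
    have hB : ∀ p, #(B p) ≤ M := by
      intro p
      by_contra! hp
      obtain ⟨A, hA, hAt, hAi⟩ := H.indep (B p) t hp.le htT
      have hAB := fun (u : V) (hu : u ∈ A) => (mem_filter.1 (hA hu)).2
      obtain ⟨u, hu⟩ : A.Nonempty := card_pos.1 (by omega)
      refine H.not_sparse hk hAt hAi ht0 hn hkt hc hγ hγc hεc hε hεγ'
        (hWdisj p.1 p.2 (hAB u hu).2.1.symm) (hWlow _) (hW _).1 (hW _).1
        (fun u hu => ?_) fun u hu => (hAB u hu).2.2.le
      have e1 := hcol u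
      rw [(hAB u hu).1] at e1
      have e2 : (hits G (W p.1) u : ℝ) + miss G (W p.1) u = #(W p.1) := by
        exact_mod_cast hits_add_miss G (W p.1) u
      linarith
    have hsub : univ \ univ.biUnion U ⊆ univ.biUnion B := by
      intro v hv
      have hv' : v ∉ U (col v) := fun h =>
        (mem_sdiff.1 hv).2 (mem_biUnion.2 ⟨_, mem_univ _, h⟩)
      simp only [U, mem_filter, mem_univ, true_and] at hv'
      push Not at hv'
      obtain ⟨j, hj, hj'⟩ := hv'
      exact mem_biUnion.2 ⟨(col v, j), mem_univ _, mem_filter.2 ⟨mem_univ _, rfl, hj, hj'⟩⟩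
    refine (card_le_card hsub).trans ((card_biUnion_le_card_mul _ _ M fun p _ => hB p).trans ?_)
    rw [card_univ, Fintype.card_prod, hr, sq]

omit [DecidableEq ι] in
/-- An independent `k`-set whose members have fewer than `a` neighbours in `S` bounds the size
of `S` together with its common non-neighbours outside `S`. -/
theorem Locality.card_add_card_le (H : Locality G ι k n β T M) {a m : ℕ}
    (hm : n + k * (a - 1) = m + 1) {Q S : Finset V} (hQ : G.IsIndepSet (Q : Set V)) (hQk : #Q = k)
    (hQS : ∀ q ∈ Q, hits G S q < a) : #S + #{v | v ∉ S ∧ ∀ q ∈ Q, ¬ G.Adj v q} ≤ m := by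
  have h1 : #S ≤ #{x ∈ S | ∀ u ∈ Q, ¬ G.Adj x u} + ∑ q ∈ Q, hits G S q := by
    convert card_le_card_filter_add_sum_hits (G := G) S Q
  have h2 : ∑ q ∈ Q, hits G S q ≤ k * (a - 1) := by
    rw [← hQk, ← smul_eq_mul]
    exact sum_le_card_nsmul _ _ _ fun q hq => Nat.le_sub_one_of_lt (hQS q hq)
  have h3 : #{v | ∀ q ∈ Q, ¬ G.Adj v q} < n := by
    convert H.book Q hQ hQk
  have h4 : #{x ∈ S | ∀ u ∈ Q, ¬ G.Adj x u} + #{v | v ∉ S ∧ ∀ q ∈ Q, ¬ G.Adj v q} ≤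
      #{v | ∀ q ∈ Q, ¬ G.Adj v q} := by
    rw [← card_union_of_disjoint]
    · refine card_le_card fun x hx => ?_
      simp only [mem_union, mem_filter, mem_univ, true_and] at hx ⊢
      tauto
    · rw [Finset.disjoint_left]
      intro x hx hx'
      exact (mem_filter.1 hx').2.1 (mem_filter.1 hx).1
  omega

theorem Locality.false_of_classes (H : Locality G ι k n β T M) (hr : Fintype.card ι = r)
    (hr0 : 0 < r) {a m t s : ℕ} (hm : n + k * (a - 1) = m + 1)
    (hN : Fintype.card V = r * m + 1) (hts : r * s + β ≤ t) (hks : k ≤ s)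
    (htT : t ≤ T) (hM : 0 < M)
    (hbig : r ^ 2 * M * (r * (2 ^ t * (r ^ 2 * M)) + 2 ^ (r * t) * M + 1) + M ≤ n)
    {U : ι → Finset V} (hUd : ∀ i j, i ≠ j → Disjoint (U i) (U j))
    (hUa : ∀ i, ∀ v ∈ U i, hits G (U i) v < a)
    (hUc : #(univ \ univ.biUnion U) ≤ r ^ 2 * M) : False := by
  have hkT : k ≤ T := by nlinarith
  have hle : ∀ i, #(U i) ≤ m := by
    intro i
    by_cases hMi : M ≤ #(U i)
    · obtain ⟨Q, hQ, hQk, hQi⟩ := H.indep (U i) k hMi hkT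
      have := H.card_add_card_le hm hQi hQk fun q hq => hUa i q (hQ hq)
      omega
    · have := Nat.zero_le (r ^ 2 * M * (r * (2 ^ t * (r ^ 2 * M)) + 2 ^ (r * t) * M + 1))
      omega
  have hge : ∀ i, m + 1 ≤ #(U i) + r ^ 2 * M := by
    intro i
    have h1 : #(univ \ univ.biUnion U) + #(univ.biUnion U) = r * m + 1 := by
      rw [card_sdiff_add_card_eq_card (subset_univ _), card_univ, hN]
    have h2 : #(univ.biUnion U) = #(U i) + ∑ j ∈ univ.erase i, #(U j) := by
      rw [card_biUnion fun i _ j _ hij => hUd i j hij, 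
        add_sum_erase _ (fun j => #(U j)) (mem_univ i)]
    have h3 : ∑ j ∈ univ.erase i, #(U j) ≤ (r - 1) * m := by
      refine (sum_le_card_nsmul _ _ m fun j _ => hle j).trans ?_
      rw [card_erase_of_mem (mem_univ i), card_univ, hr, smul_eq_mul]
    obtain ⟨l, rfl⟩ : ∃ l, r = l + 1 := ⟨r - 1, by omega⟩
    rw [Nat.add_sub_cancel] at h3
    rw [add_mul, one_mul] at h1
    omega
  have hcol : ∀ v, ∃ i, hits G (U i) v < r * (2 ^ t * (r ^ 2 * M)) + 2 ^ (r * t) * M := by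
    intro v
    by_contra! hc
    obtain ⟨A, hA, hJ⟩ := exists_joined (G := G) (fun i => {x ∈ U i | G.Adj v x}) (t := t)
      (s := s) (E := 2 ^ t * (r ^ 2 * M)) (M := M) hM univ
      (fun i _ Y hY hMY => by
        obtain ⟨A, hA, hAt, hAi⟩ := H.indep Y t hMY htT
        refine ⟨A, hA, hAt, fun j _ hji => ?_⟩
        have hAU : A ⊆ U i := (hA.trans hY).trans (filter_subset _ _)
        have hsub : ({w ∈ {x ∈ U j | G.Adj v x} | s < miss G A w} : Finset V) ⊆
            (powersetCard k A).biUnion fun Q => {w | w ∉ U i ∧ ∀ q ∈ Q, ¬ G.Adj w q} := by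
          intro w hw
          obtain ⟨hw1, hw2⟩ := mem_filter.1 hw
          obtain ⟨Q, hQ, hQk⟩ := exists_subset_card_eq (hks.trans hw2.le)
          refine mem_biUnion.2 ⟨Q, mem_powersetCard.2 ⟨hQ.trans (filter_subset _ _), hQk⟩, ?_⟩
          refine mem_filter.2 ⟨mem_univ _, fun hwi => ?_, fun q hq => (mem_filter.1 (hQ hq)).2⟩
          exact Finset.disjoint_left.1 (hUd i j hji.symm) hwi (mem_filter.1 hw1).1
        refine (card_le_card hsub).trans
          ((card_biUnion_le_card_mul _ _ (r ^ 2 * M) fun Q hQ => ?_).trans ?_)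
        · obtain ⟨hQA, hQk⟩ := mem_powersetCard.1 hQ
          have h1 := H.card_add_card_le hm (hAi.mono (coe_subset.2 hQA)) hQk
            fun q hq => hUa i q (hAU (hQA hq))
          have h2 := hge i
          omega
        · rw [card_powersetCard, hAt]
          exact Nat.mul_le_mul_right _ (Nat.choose_le_two_pow _ _))
      (fun i _ => by rw [hr]; exact hc i)
    refine H.free v A hJ fun i => ?_
    obtain ⟨h1, h2⟩ := hA i (mem_univ i)
    rw [hits_eq_card fun x hx => (mem_filter.1 (h1 hx)).2]
    rw [card_univ, hr] at h2
    omega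
  choose col hcol using hcol
  set P := r * (2 ^ t * (r ^ 2 * M)) + 2 ^ (r * t) * M
  set R := univ \ univ.biUnion U
  obtain ⟨i, -, hi⟩ : ∃ i ∈ (univ : Finset ι), m < #(U i ∪ {v ∈ R | col v = i}) := by
    refine exists_lt_of_sum_lt ?_
    rw [sum_const, card_univ, hr, smul_eq_mul]
    refine (Nat.lt_succ_self _).trans_le ?_
    rw [Nat.succ_eq_add_one, ← hN, ← card_univ]
    refine le_trans (card_le_card fun v _ => ?_) card_biUnion_le
    by_cases hv : v ∈ univ.biUnion U
    · obtain ⟨j, hj, hvj⟩ := mem_biUnion.1 hv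
      exact mem_biUnion.2 ⟨j, hj, mem_union_left _ hvj⟩
    · exact mem_biUnion.2 ⟨col v, mem_univ _, mem_union_right _
        (mem_filter.2 ⟨mem_sdiff.2 ⟨mem_univ _, hv⟩, rfl⟩)⟩
  have h1 : #(U i) ≤ #{x ∈ U i | ∀ u ∈ ({v ∈ R | col v = i} : Finset V), ¬ G.Adj x u} +
      ∑ u ∈ R with col u = i, hits G (U i) u := by
    convert card_le_card_filter_add_sum_hits (G := G) (U i) {v ∈ R | col v = i}
  have h2 : ∑ u ∈ R with col u = i, hits G (U i) u ≤ r ^ 2 * M * P := by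
    refine (sum_le_card_nsmul _ _ P fun u hu => ?_).trans
      (Nat.mul_le_mul_right _ ((card_filter_le _ _).trans hUc))
    exact (mem_filter.1 hu).2 ▸ (hcol u).le
  have h3 := hge i
  rw [mul_add, mul_one] at hbig
  obtain ⟨Q, hQ, hQk, hQi⟩ := H.indep _ k
    (show M ≤ #{x ∈ U i | ∀ u ∈ ({v ∈ R | col v = i} : Finset V), ¬ G.Adj x u} by omega) hkT
  have h4 := H.card_add_card_le (S := U i ∪ {v ∈ R | col v = i}) hm hQi hQk fun q hq => by
    obtain ⟨hq1, hq2⟩ := mem_filter.1 (hQ hq)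
    refine lt_of_le_of_lt (card_le_card fun x hx => ?_) (hUa i q hq1)
    obtain ⟨hx1, hx2⟩ := mem_filter.1 hx
    refine mem_filter.2 ⟨(mem_union.1 hx1).resolve_right fun h => hq2 x h hx2, hx2⟩
  omega

end

section
open Finset

/-- The constants of the argument that do not depend on the size of the forbidden graph. -/
theorem exists_parameters {k r : ℕ} (a : ℕ) (hk : 0 < k) (hr0 : 0 < r) :
    ∃ c γ θ ε : ℝ, ∃ q L : ℕ, 0 < c ∧ (a + 1) * (8 * c) ≤ 1 / 4 ∧ 0 < γ ∧ γ ≤ 1 / 4 ∧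
      4 * k * γ ≤ c ^ k ∧ 4 ≤ q ∧ r + 1 ≤ q ∧ 0 < θ ∧ θ ≤ 1 ∧ θ = (1 / (2 * q)) ^ k ∧ 0 < ε ∧
      8 * r * ε ≤ 1 ∧ ε ≤ c ∧ 12 * r ^ 2 * ε ≤ γ * θ ^ 2 ∧ 2 ≤ L ∧ 2 * k ≤ ε * L := by
  have hk1 : (1 : ℝ) ≤ k := by exact_mod_cast hk
  have hr1 : (1 : ℝ) ≤ r := by exact_mod_cast hr0
  obtain ⟨c, hc⟩ : ∃ c : ℝ, c = 1 / (32 * (a + 1)) := ⟨_, rfl⟩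
  have hc0 : 0 < c := by rw [hc]; positivity
  have hc1 : (a + 1) * (8 * c) ≤ 1 / 4 := by
    rw [hc]
    field_simp
    norm_num
  have hc2 : c ≤ 1 := by
    have : (0 : ℝ) ≤ a := by positivity
    nlinarith
  obtain ⟨γ, hγ⟩ : ∃ γ : ℝ, γ = c ^ k / (4 * k) := ⟨_, rfl⟩
  have hγ0 : 0 < γ := by rw [hγ]; positivity
  have hγc : 4 * k * γ = c ^ k := by
    rw [hγ]
    field_simp
  have hck : c ^ k ≤ c := pow_le_of_le_one hc0.le hc2 hk.ne'
  have hkγ : γ ≤ k * γ := le_mul_of_one_le_left hγ0.le hk1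
  obtain ⟨θ, hθ⟩ : ∃ θ : ℝ, θ = (1 / (2 * (2 * (r + 1) : ℕ))) ^ k := ⟨_, rfl⟩
  have hθ0 : 0 < θ := by rw [hθ]; positivity
  have hθ1 : θ ≤ 1 := by
    rw [hθ]
    refine pow_le_one₀ (by positivity) ?_
    rw [div_le_one (by positivity)]
    push_cast
    linarith
  have hθ2 : θ ^ 2 ≤ 1 := pow_le_one₀ hθ0.le hθ1
  obtain ⟨ε, hε⟩ : ∃ ε : ℝ, ε = γ * θ ^ 2 / (12 * r ^ 2) := ⟨_, rfl⟩
  have hε0 : 0 < ε := by rw [hε]; positivity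
  have hεγ : 12 * r ^ 2 * ε = γ * θ ^ 2 := by
    rw [hε]
    field_simp
  have hγθ : γ * θ ^ 2 ≤ γ := mul_le_of_le_one_right hγ0.le hθ2
  have hrε : r * ε ≤ r ^ 2 * ε := by
    gcongr
    nlinarith
  have hrε' : ε ≤ r * ε := le_mul_of_one_le_left hε0.le hr1
  refine ⟨c, γ, θ, ε, 2 * (r + 1), ⌈2 * k / ε⌉₊ + 2, hc0, hc1, hγ0, by linarith, hγc.le, by omega,
    by omega, hθ0, hθ1, hθ, hε0, by linarith, by linarith, hεγ.le, by omega, ?_⟩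
  have h := Nat.le_ceil (2 * k / ε)
  rw [div_le_iff₀ hε0] at h
  push_cast
  linarith

set_option maxHeartbeats 400000 in
/-- A sufficiently large graph on `r * (n + k * (a - 1) - 1) + 1` vertices, where `n` is
exponential in `β`, cannot satisfy the local conditions. -/
theorem Locality.exists_threshold {k r : ℕ} (a : ℕ) (hk : 0 < k) (hr0 : 0 < r) :
    ∃ C C₀ τ : ℕ, 0 < C ∧ a ≤ C₀ ∧ k ≤ C₀ ∧ ∀ β n : ℕ, C₀ ≤ β → 2 ^ (C * β) ≤ n →
      ∀ {V ι : Type} [Fintype V] [DecidableEq V] [Fintype ι] [DecidableEq ι]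
        (G : SimpleGraph V) [DecidableRel G.Adj], Fintype.card ι = r →
        ∀ m, n + k * (a - 1) = m + 1 → Fintype.card V = r * m + 1 →
        Locality G ι k n β (τ * β) (2 ^ (r * β + 1 + τ * β)) →
        ¬ ∀ (v : V) (i : ι) (F : ι → Finset V), JoinedFam G univ F →
          (∀ j, ∀ x ∈ F j, G.Adj v x) → a ≤ #(F i) → ¬ ∀ j, j ≠ i → β ≤ #(F j) := by
  obtain ⟨c, γ, θ, ε, q, L, hc, hca, hγ, hγ1, hγc, hq, hrq, hθ0, hθ1, hθ, hε, hεr, hεc, hεγ, hL,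
    hkL⟩ := exists_parameters a hk hr0
  obtain ⟨τ, hτ⟩ : ∃ τ, τ = L ^ r * (q * L) := ⟨_, rfl⟩
  obtain ⟨D, hD⟩ : ∃ D, D = (r + 1) * (τ + 1) := ⟨_, rfl⟩
  obtain ⟨K, hK⟩ : ∃ K, K = 4 * r + 2 + ⌈2 / γ⌉₊ + ⌈1 / ε⌉₊ + r ^ 5 + 2 * r ^ 2 + 1 := ⟨_, rfl⟩
  have hD0 : 0 < D := by rw [hD]; positivity
  refine ⟨4 * D, K + k + a, τ, by omega, by omega, by omega, ?_⟩
  intro β n hβ hn V ι _ _ _ _ G _ hr m hm hN H star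
  have hβ0 : 0 < β := by omega
  have hkβ : k ≤ β := by omega
  obtain ⟨s, hs⟩ : ∃ s, s = L * β := ⟨_, rfl⟩
  obtain ⟨t, ht⟩ : ∃ t, t = q * s := ⟨_, rfl⟩
  obtain ⟨M, hMd⟩ : ∃ M, M = 2 ^ (r * β + 1 + τ * β) := ⟨_, rfl⟩
  obtain ⟨Z, hZ⟩ : ∃ Z, Z = 2 ^ (D * β) := ⟨_, rfl⟩
  rw [← hMd] at H
  have hT : τ * β = L ^ r * t := by rw [hτ, ht, hs]; ring
  have hM : 0 < M := by rw [hMd]; positivity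
  have h2β : 2 * β ≤ s := hs ▸ Nat.mul_le_mul_right _ hL
  have hst : (r + 1) * s ≤ t := ht ▸ Nat.mul_le_mul_right _ hrq
  have hst1 : s ≤ t := (Nat.le_mul_of_pos_left s r.succ_pos).trans hst
  have htT : t ≤ τ * β := hT ▸ Nat.le_mul_of_pos_left _ (by positivity)
  have hε2 : 2 * k * β ≤ ε * t := by
    have e1 : (2 * k * β : ℝ) ≤ ε * L * β := by gcongr
    have e2 : ε * s ≤ ε * t := by gcongr
    rw [hs] at e2
    push_cast at e2
    linarith
  have hkβ' : (k : ℝ) ≤ β := by exact_mod_cast hkβ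
  have hkk : (k : ℝ) * k ≤ k * β := by gcongr
  have hDβ : (r + 1) * (τ + 1) * β = r * β + τ * β + β + r * (τ * β) := by ring
  have hMZ : M ≤ Z := by
    rw [hMd, hZ, hD]
    refine Nat.pow_le_pow_right two_pos ?_
    omega
  have hrTZ : 2 ^ (r * (τ * β)) ≤ Z := by
    rw [hZ, hD]
    refine Nat.pow_le_pow_right two_pos ?_
    omega
  have hrtZ : 2 ^ (r * t) ≤ Z :=
    (Nat.pow_le_pow_right two_pos (Nat.mul_le_mul_left _ htT)).trans hrTZ
  have htZ : 2 ^ t ≤ Z :=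
    (Nat.pow_le_pow_right two_pos (Nat.le_mul_of_pos_left _ hr0)).trans hrtZ
  have hKZ : K ≤ Z := by
    refine (Nat.lt_two_pow_self (n := K)).le.trans ?_
    rw [hZ]
    refine Nat.pow_le_pow_right two_pos ?_
    have : 1 * β ≤ D * β := Nat.mul_le_mul_right _ hD0
    omega
  have hZ1 : 1 ≤ Z := by omega
  have hZn : Z ^ 4 ≤ n := by
    rw [hZ, ← pow_mul]
    convert hn using 2
    ring
  have hKn : K * Z ^ 3 ≤ n := le_trans (by rw [pow_succ' Z 3]; gcongr) hZn
  have hKn1 : K ≤ n := (Nat.le_mul_of_pos_right _ (by positivity)).trans hKn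
  have hZ2 : Z * Z ≤ Z ^ 3 := sq Z ▸ Nat.pow_le_pow_right hZ1 (by norm_num)
  have hZ3 : Z ≤ Z ^ 3 := Nat.le_self_pow (by norm_num) Z
  have hK1 : (1 / ε : ℝ) ≤ K := by
    refine (Nat.le_ceil _).trans ?_
    exact_mod_cast (by omega : ⌈1 / ε⌉₊ ≤ K)
  have hK2 : (2 / γ : ℝ) ≤ K := by
    refine (Nat.le_ceil _).trans ?_
    exact_mod_cast (by omega : ⌈2 / γ⌉₊ ≤ K)
  have hKn1' : (K : ℝ) ≤ n := by exact_mod_cast hKn1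
  have hrN : r * n ≤ Fintype.card V + r := by
    have : r * n ≤ r * (m + 1) := Nat.mul_le_mul_left _ (by omega)
    rw [hN]
    rw [mul_add] at this
    omega
  obtain ⟨A, hJ, hA⟩ := H.exists_system (ε := ε) hM hr hrN (L := L) (t := t) (by omega) (by omega)
    hε hεr (by linarith) (by linarith) hT.ge
    (by
      calc 2 * (2 ^ (r * (τ * β)) * M) ≤ K * (Z * Z) := by gcongr; omega
        _ ≤ K * Z ^ 3 := by gcongr
        _ ≤ n := hKn) (by omega)
  obtain ⟨W, hW, hWd, hWE⟩ := H.exists_cores hM hr hr0 hrN hε hεr ht hq (by omega) (by omega)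
    (by omega) (by linarith only [hε2, hkk]) hθ htT
    (by
      rw [div_le_iff₀ hε, mul_comm] at hK1
      exact hK1.trans (by gcongr)) hJ hA
  obtain ⟨U, hUd, hUa, hUc⟩ := H.exists_classes hM hr hr0 hk (by omega) hε ht hrq (by omega)
    (by omega) (by linarith [show (0 : ℝ) ≤ k * β by positivity]) htT hθ0 hθ1 hc hca hγ hγ1 hγc
    hεc hεγ
    (by
      have e1 : 2 ^ (r * t) * (2 ^ (r * t) * M) ≤ Z ^ 3 := by
        calc _ ≤ Z * (Z * Z) := by gcongr
          _ = Z ^ 3 := by ring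
      have e2 : ((2 ^ (r * t) * (2 ^ (r * t) * M) : ℕ) : ℝ) ≤ Z ^ 3 := by exact_mod_cast e1
      have e3 : (K : ℝ) * Z ^ 3 ≤ n := by exact_mod_cast hKn
      rw [div_le_iff₀ hγ] at hK2
      have e4 : (2 : ℝ) * Z ^ 3 ≤ K * γ * Z ^ 3 := by gcongr
      have e5 : γ * (K * Z ^ 3) ≤ γ * n := by gcongr
      linarith only [e2, e4, e5]) star hW hWd hWE
  refine H.false_of_classes hr hr0 hm hN (t := t) (s := s) ?_ (by omega) htT hM ?_ hUd hUa hUc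
  · rw [add_mul] at hst
    omega
  · calc r ^ 2 * M * (r * (2 ^ t * (r ^ 2 * M)) + 2 ^ (r * t) * M + 1) + M
        ≤ r ^ 2 * Z * (r * (Z * (r ^ 2 * Z)) + Z * Z + Z * Z) + Z ^ 3 := by
          gcongr
          · exact one_le_mul hZ1 hZ1
          · exact hMZ.trans hZ3
      _ = (r ^ 5 + 2 * r ^ 2 + 1) * Z ^ 3 := by ring
      _ ≤ K * Z ^ 3 := by gcongr; omega
      _ ≤ n := hKn

theorem hasCopy_of_joinedFam {V : Type*} {G : SimpleGraph V} {ι : Type*} [Fintype ι] {f : ι → ℕ}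
    {B : ι → Finset V} (hB : JoinedFam G univ B) (hf : ∀ i, f i ≤ #(B i)) :
    HasCopy G (completeMultipartiteGraph fun i => Fin (f i)) := by
  have e : ∀ i, Fin (f i) ↪ B i := fun i =>
    (Function.Embedding.nonempty_of_card_le (by simpa using hf i)).some
  have hadj : ∀ x y : Σ i, Fin (f i), x.1 ≠ y.1 → G.Adj (e x.1 x.2) (e y.1 y.2) := fun x y hxy =>
    hB _ (mem_univ _) _ (mem_univ _) hxy _ (e x.1 x.2).2 _ (e y.1 y.2).2
  refine ⟨⟨fun x => e x.1 x.2, fun {x y} h => hadj x y h⟩, fun x y hxy => ?_⟩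
  by_cases h : x.1 = y.1
  · obtain ⟨i, x⟩ := x
    obtain ⟨j, y⟩ := y
    obtain rfl : i = j := h
    obtain rfl : x = y := (e i).injective (Subtype.ext hxy)
    rfl
  · exact absurd hxy (hadj x y h).ne

theorem hasCopy_of_isClique {V W : Type*} {G : SimpleGraph V} [Fintype W] (H : SimpleGraph W)
    {C : Finset V} (hC : G.IsClique (C : Set V)) (hW : Fintype.card W ≤ #C) : HasCopy G H := by
  obtain ⟨e⟩ : Nonempty (W ↪ C) := Function.Embedding.nonempty_of_card_le (by simpa using hW)
  refine ⟨⟨fun x => e x, fun {x y} h => hC (e x).2 (e y).2 fun hxy => ?_⟩, fun x y hxy => ?_⟩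
  · exact h.ne (e.injective (Subtype.ext hxy))
  · exact e.injective (Subtype.ext hxy)

/-- An independent `k`-set with `n` common non-neighbours, counting its own elements, spans a book
in the complement. -/
theorem hasCopy_book {V : Type*} [Fintype V] [DecidableEq V] {G : SimpleGraph V}
    [DecidableRel G.Adj] {k n : ℕ} {Q : Finset V} (hQ : G.IsIndepSet (Q : Set V)) (hQk : #Q = k)
    (hn : n ≤ #{v | ∀ q ∈ Q, ¬ G.Adj v q}) : HasCopy Gᶜ (Book k n) := by
  set D : Finset V := {v | ∀ q ∈ Q, ¬ G.Adj v q} with hD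
  have hQD : n - k ≤ #(D \ Q) := by
    have := le_card_sdiff Q D
    omega
  let e : Fin k ≃ Q := (Q.equivFinOfCardEq hQk).symm
  let B : Fin (k + 1) → Finset V := fun i => if h : (i : ℕ) < k then {(e ⟨i, h⟩ : V)} else D \ Q
  have hBD : ∀ i : Fin (k + 1), ¬ (i : ℕ) < k → ∀ j : Fin (k + 1), (j : ℕ) < k →
      ∀ x ∈ B i, ∀ y ∈ B j, Gᶜ.Adj x y := by
    intro i hi j hj x hx y hy
    simp only [B, hi, hj, dif_pos, dif_neg, not_false_eq_true, mem_sdiff, mem_singleton] at hx hy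
    have hyQ : y ∈ Q := hy ▸ (e _).2
    exact ⟨fun h => hx.2 (h ▸ hyQ), (mem_filter.1 hx.1).2 y hyQ⟩
  refine hasCopy_of_joinedFam (B := B) (fun i _ j _ hij x hx y hy => ?_) fun i => ?_
  · by_cases hi : (i : ℕ) < k <;> by_cases hj : (j : ℕ) < k
    · simp only [B, hi, hj, dif_pos, mem_singleton] at hx hy
      subst hx hy
      have hne : (e ⟨i, hi⟩ : V) ≠ e ⟨j, hj⟩ := fun h => hij <| by
        simpa [Fin.ext_iff] using e.injective (Subtype.ext h)
      exact ⟨hne, hQ (e _).2 (e _).2 hne⟩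
    · exact (hBD j hj i hi y hy x hx).symm
    · exact hBD i hi j hj x hx y hy
    · exact absurd (Fin.ext (by omega)) hij
  · by_cases hi : (i : ℕ) < k
    · simp [B, hi]
    · simpa [B, hi] using hQD

theorem hasCopy_kMulti {V : Type*} {G : SimpleGraph V} {a b r : ℕ} {v : V} {i : Fin r}
    {F : Fin r → Finset V} (hF : JoinedFam G univ F) (hv : ∀ j, ∀ x ∈ F j, G.Adj v x)
    (ha : a ≤ #(F i)) (hb : ∀ j, j ≠ i → b ≤ #(F j)) :
    HasCopy G (KMulti fun j : Fin (r + 1) => if (j : ℕ) = 0 then 1 else if (j : ℕ) = 1 then a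
      else b) := by
  have hr : 0 < r := i.pos
  let σ : Fin r ≃ Fin r := Equiv.swap ⟨0, hr⟩ i
  have hvF : ∀ j l, j ≠ l → ∀ x ∈ F (σ j), ∀ y ∈ F (σ l), G.Adj x y := fun j l hjl =>
    hF _ (mem_univ _) _ (mem_univ _) (σ.injective.ne hjl)
  refine hasCopy_of_joinedFam (B := Fin.cons {v} (F ∘ σ)) (fun j _ l _ hjl => ?_) fun j => ?_
  · induction j using Fin.cases with
    | zero =>
      induction l using Fin.cases with
      | zero => exact absurd rfl hjl
      | succ l =>
        intro x hx y hy
        rw [Fin.cons_zero, mem_singleton] at hx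
        exact hx ▸ hv _ y hy
    | succ j =>
      induction l using Fin.cases with
      | zero =>
        intro x hx y hy
        rw [Fin.cons_zero, mem_singleton] at hy
        exact hy ▸ (hv _ x hx).symm
      | succ l => exact hvF j l fun h => hjl (h ▸ rfl)
  · induction j using Fin.cases with
    | zero => simp
    | succ j =>
      by_cases hj : (j : ℕ) = 0
      · obtain rfl : j = ⟨0, hr⟩ := Fin.ext hj
        have hσ : σ ⟨0, hr⟩ = i := Equiv.swap_apply_left _ _
        rw [Fin.cons_succ, Function.comp_apply, hσ]
        simpa using ha
      · have hj' : j ≠ ⟨0, hr⟩ := fun h => hj (congrArg Fin.val h)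
        have hσ : σ j ≠ i := fun h => hj' (σ.injective (h.trans (Equiv.swap_apply_left _ _).symm))
        simpa [hj] using hb _ hσ

/-- The local conditions hold when neither graph embeds. -/
theorem locality_of_not_hasCopy {V : Type*} [Fintype V] [DecidableEq V] {G : SimpleGraph V}
    [DecidableRel G.Adj] {k n a b r β T : ℕ} (hr : 0 < r) (ha : a ≤ β) (hb : b ≤ β)
    (h₁ : ¬ HasCopy G (KMulti fun j : Fin (r + 1) => if (j : ℕ) = 0 then 1 else
      if (j : ℕ) = 1 then a else b))
    (h₂ : ¬ HasCopy Gᶜ (Book k n)) : Locality G (Fin r) k n β T (2 ^ (r * β + 1 + T)) where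
  book Q hQ hQk := by
    by_contra! h
    exact h₂ (hasCopy_book hQ hQk (h.trans_eq (by congr!)))
  free v A hA h := by
    have hle : ∀ i, β ≤ #{x ∈ A i | G.Adj v x} := h
    exact h₁ (hasCopy_kMulti (v := v) (i := ⟨0, hr⟩) (hA.mono fun i _ => filter_subset (G.Adj v) _)
      (fun j x hx => (mem_filter.1 hx).2) (ha.trans (hle _)) fun j _ => hb.trans (hle j))
  indep Y τ hY hτ := by
    refine (exists_isClique_or_isIndepSet G (r * β + 1) τ Y
      ((Nat.pow_le_pow_right two_pos (by omega)).trans hY)).resolve_left ?_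
    rintro ⟨C, -, hCc, hC⟩
    refine h₁ (hasCopy_of_isClique _ hC ?_)
    rw [hCc, Fintype.card_sigma, Fin.sum_univ_succ, add_comm]
    refine Nat.add_le_add ?_ (by simp)
    refine (sum_le_card_nsmul _ _ β fun j _ => ?_).trans (by simp)
    simp only [Fintype.card_fin, Fin.val_succ, Nat.add_eq_zero_iff, one_ne_zero, and_false,
      if_false]
    split_ifs <;> assumption

end

/-- Theorem 1.6 (upper bound): for all `k, a ≥ 1`, `p ≥ 2` there are `δ > 0` and `n₀` such
that for all `n ≥ n₀` and `1 ≤ b ≤ δ ln n`,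
`r(K_p(1,a,b,…,b), B_{k,n}) ≤ (p-1)(n-1) + k(p-1)(a-1) + 1`. -/
theorem ramsey_book_logparts_upper (k a p : ℕ) (hk : 1 ≤ k) (ha : 1 ≤ a) (hp : 2 ≤ p) :
    ∃ δ : ℝ, 0 < δ ∧ ∃ n₀ : ℕ, ∀ n : ℕ, n₀ ≤ n →
      ∀ b : ℕ, 1 ≤ b → (b : ℝ) ≤ δ * Real.log n →
        ramseyNumber
          (KMulti (fun i : Fin p => if (i : ℕ) = 0 then 1 else if (i : ℕ) = 1 then a else b))
          (Book k n) ≤ (p - 1) * (n - 1) + k * (p - 1) * (a - 1) + 1 := by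
  obtain ⟨r, rfl⟩ : ∃ r, p = r + 1 := ⟨p - 1, by omega⟩
  have hr0 : 0 < r := by omega
  obtain ⟨C, C₀, τ, hC, haC, hkC, H⟩ := Locality.exists_threshold a hk hr0
  refine ⟨1 / C, by positivity, 2 ^ (C * C₀), fun n hn b hb hbn => Nat.sInf_le fun G => ?_⟩
  have hn1 : 1 ≤ n := Nat.one_le_two_pow.trans hn
  by_contra! hG
  classical
  have hbn' : 2 ^ (C * b) ≤ n := by
    have h1 : ((C * b : ℕ) : ℝ) ≤ Real.log n := by
      rw [one_div, inv_mul_eq_div, le_div_iff₀ (by positivity), mul_comm] at hbn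
      exact_mod_cast hbn
    have h2 : (2 : ℝ) ≤ Real.exp 1 := by linarith [Real.add_one_le_exp (1 : ℝ)]
    have h3 : (2 : ℝ) ^ (C * b) ≤ n := by
      calc (2 : ℝ) ^ (C * b) ≤ Real.exp 1 ^ (C * b) := by gcongr
        _ = Real.exp (C * b : ℕ) := by rw [← Real.exp_nat_mul, mul_one]
        _ ≤ Real.exp (Real.log n) := Real.exp_le_exp.2 h1
        _ = n := Real.exp_log (by exact_mod_cast hn1)
    exact_mod_cast h3
  obtain ⟨m, hm⟩ : ∃ m, n + k * (a - 1) = m + 1 := ⟨n + k * (a - 1) - 1, by omega⟩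
  have hcard : Fintype.card (Fin ((r + 1 - 1) * (n - 1) + k * (r + 1 - 1) * (a - 1) + 1)) =
      r * m + 1 := by
    obtain ⟨l, rfl⟩ : ∃ l, n = l + 1 := ⟨n - 1, by omega⟩
    obtain rfl : m = l + k * (a - 1) := by omega
    simp only [Fintype.card_fin, Nat.add_sub_cancel]
    ring
  refine H (max b C₀) n (le_max_right _ _) ?_ G (Fintype.card_fin r) m hm hcard
    (locality_of_not_hasCopy hr0 (haC.trans (le_max_right _ _)) (le_max_left _ _) hG.1 hG.2)
    fun v i F hF hv hai hβ => hG.1 ?_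
  · rcases max_choice b C₀ with h | h <;> rw [h] <;> assumption
  · exact hasCopy_kMulti hF hv hai fun j hj => (le_max_left _ _).trans (hβ j hj)
end

section
/- For every integer k ≥ 1 and p ≥ 2 there exist δ > 0 and n₀ such that for all n ≥ n₀, r(K_p(1,1,⌈δ ln n⌉,…,⌈δ ln n⌉), B_{k,n}) = (p−1)(n−1) + 1, where K_p(1,1,⌈δ ln n⌉,…,⌈δ ln n⌉) is the complete p-partite graph with two parts of size 1 and p−2 parts of size ⌈δ ln n⌉. -/
open SimpleGraph

open Finset in
/-- Splitting a finite set of `r * k` elements into `r` blocks of size `k`. -/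
theorem exists_disjoint_blocks {V : Type*} [DecidableEq V] {r k : ℕ} (S : Finset V)
    (hS : S.card = r * k) :
    ∃ B : Fin r → Finset V, (∀ b, B b ⊆ S) ∧ (∀ b, (B b).card = k) ∧
      ∀ b c, b ≠ c → Disjoint (B b) (B c) := by
  let e : Fin r × Fin k ≃ S := finProdFinEquiv.trans (S.equivFinOfCardEq hS).symm
  have hinj : ∀ x y, (e x : V) = e y → x = y := fun x y h => e.injective (Subtype.ext h)
  refine ⟨fun b => univ.image fun j => (e (b, j) : V), fun b => ?_, fun b => ?_, fun b c hbc => ?_⟩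
  · intro x hx
    obtain ⟨j, -, rfl⟩ := mem_image.1 hx
    exact (e (b, j)).2
  · rw [card_image_of_injective, card_univ, Fintype.card_fin]
    intro i j h
    simpa using hinj _ _ h
  · rw [Finset.disjoint_left]
    intro x hx hy
    obtain ⟨i, -, rfl⟩ := mem_image.1 hx
    obtain ⟨j, -, h⟩ := mem_image.1 hy
    exact hbc (congrArg Prod.fst (hinj _ _ h)).symm

open Finset in
/-- A graph containing pairwise completely joined sets of sizes at least `a i` contains the
complete multipartite graph with parts of sizes `a i`. -/
theorem hasCopy_kMulti_of_sets {V : Type*} {G : SimpleGraph V} {p : ℕ} {a : Fin p → ℕ}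
    (A : Fin p → Finset V) (ha : ∀ i, a i ≤ (A i).card)
    (hA : ∀ i j, i ≠ j → ∀ x ∈ A i, ∀ y ∈ A j, G.Adj x y) : HasCopy G (KMulti a) := by
  let e (i : Fin p) : Fin (a i) → V := fun x => ((A i).equivFin.symm (Fin.castLE (ha i) x) : V)
  have he (i x) : e i x ∈ A i := ((A i).equivFin.symm (Fin.castLE (ha i) x)).2
  have hinj (i) : Function.Injective (e i) := by
    intro x y h
    simpa using (A i).equivFin.symm.injective (Subtype.ext h)
  refine ⟨⟨fun v => e v.1 v.2, ?_⟩, ?_⟩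
  · rintro ⟨i, x⟩ ⟨j, y⟩ h
    exact hA i j h _ (he i x) _ (he j y)
  · rintro ⟨i, x⟩ ⟨j, y⟩ h
    by_cases hij : i = j
    · subst hij
      exact congrArg _ (hinj i h)
    · exact absurd h (hA i j hij _ (he i x) _ (he j y)).ne

open Finset in
/-- An exponential bound for two-colour Ramsey numbers. -/
theorem exists_isNClique_or_isIndepSet {V : Type*} (G : SimpleGraph V) (a b : ℕ) (W : Finset V)
    (hW : 2 ^ (a + b) ≤ W.card) :
    (∃ C ⊆ W, C.card = a ∧ G.IsClique (C : Set V)) ∨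
      ∃ I ⊆ W, I.card = b ∧ G.IsIndepSet (I : Set V) := by
  classical
  induction a generalizing b W with
  | zero => exact Or.inl ⟨∅, by simp⟩
  | succ a iha =>
    induction b generalizing W with
    | zero => exact Or.inr ⟨∅, by simp⟩
    | succ b ihb =>
      obtain ⟨v, hv⟩ : W.Nonempty := by
        rw [← card_pos]
        exact lt_of_lt_of_le (by positivity) hW
      have hsplit := card_filter_add_card_filter_not (s := W.erase v) (fun u => G.Adj v u)
      rw [card_erase_of_mem hv] at hsplit
      have hpow : 2 ^ (a + 1 + (b + 1)) = 2 * 2 ^ (a + (b + 1)) := by ring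
      have hpow' : 2 ^ (a + 1 + b) = 2 ^ (a + (b + 1)) := by ring
      rw [hpow] at hW
      rcases le_or_gt (2 ^ (a + (b + 1))) ((W.erase v).filter fun u => G.Adj v u).card with h | h
      · rcases iha (b + 1) _ h with ⟨C, hC, hc, hcl⟩ | ⟨I, hI, hi⟩
        · have hvC : v ∉ C := fun h => by simpa using hC h
          refine Or.inl ⟨insert v C, ?_, by rw [card_insert_of_notMem hvC, hc], ?_⟩
          · exact insert_subset hv (hC.trans ((filter_subset _ _).trans (erase_subset _ _)))
          · rw [coe_insert]
            exact hcl.insert fun u hu _ => (mem_filter.1 (hC hu)).2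
        · exact Or.inr ⟨I, hI.trans ((filter_subset _ _).trans (erase_subset _ _)), hi⟩
      · have h' : 2 ^ (a + 1 + b) ≤ ((W.erase v).filter fun u => ¬ G.Adj v u).card := by
          rw [hpow']
          omega
        rcases ihb _ h' with ⟨C, hC, hc⟩ | ⟨I, hI, hi, hind⟩
        · exact Or.inl ⟨C, hC.trans ((filter_subset _ _).trans (erase_subset _ _)), hc⟩
        · have hvI : v ∉ I := fun h => by simpa using hI h
          refine Or.inr ⟨insert v I, ?_, by rw [card_insert_of_notMem hvI, hi], ?_⟩
          · exact insert_subset hv (hI.trans ((filter_subset _ _).trans (erase_subset _ _)))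
          · rw [coe_insert]
            refine Set.Pairwise.insert hind fun u hu _ => ?_
            have := (mem_filter.1 (hI hu)).2
            exact ⟨this, fun h => this h.symm⟩

open Finset in
/-- If the complement of `G` contains no book, then every independent `k`-set of `G` dominates
many vertices. -/
theorem card_le_card_dominated {V : Type*} [Fintype V] {G : SimpleGraph V} [DecidableRel G.Adj]
    {k n : ℕ} (hG : ¬ HasCopy Gᶜ (Book k n)) {T : Finset V}
    (hT : T.card = k) (hind : G.IsIndepSet (T : Set V)) :
    Fintype.card V + 1 ≤ (univ.filter fun v => ∃ u ∈ T, G.Adj u v).card + n := by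
  classical
  by_contra! hlt
  apply hG
  set D := univ.filter fun v => ∃ u ∈ T, G.Adj u v with hD
  have hTD : (T ∪ D)ᶜ.card ≥ n - k := by
    have := card_union_le T D
    rw [card_compl]
    omega
  let e := T.equivFinOfCardEq hT
  refine hasCopy_kMulti_of_sets
    (fun i : Fin (k + 1) => if h : (i : ℕ) < k then {(e.symm ⟨i, h⟩ : V)} else (T ∪ D)ᶜ) ?_ ?_
  · intro i
    by_cases h : (i : ℕ) < k
    · simp [h]
    · simpa [h] using hTD
  · have key : ∀ (x : Fin k) (y : V), y ∈ (T ∪ D)ᶜ → Gᶜ.Adj (e.symm x : V) y := by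
      intro x y hy
      simp only [mem_compl, mem_union, hD, mem_filter, mem_univ, true_and, not_or, not_exists,
        not_and] at hy
      refine ⟨?_, hy.2 _ (e.symm x).2⟩
      rintro rfl
      exact hy.1 (e.symm x).2
    intro i j hij x hx y hy
    by_cases hi : (i : ℕ) < k <;> by_cases hj : (j : ℕ) < k <;>
      simp only [hi, hj, dite_true, dite_false, mem_singleton] at hx hy
    · subst hx hy
      have hne : (e.symm ⟨i, hi⟩ : V) ≠ e.symm ⟨j, hj⟩ := by
        intro h
        apply hij
        simpa [Fin.ext_iff] using e.symm.injective (Subtype.ext h)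
      exact ⟨hne, hind (e.symm _).2 (e.symm _).2 hne⟩
    · subst hx
      exact key _ _ hy
    · subst hy
      exact (key _ _ hx).symm
    · exact absurd (Fin.ext (by omega)) hij

open Finset in
/-- Averaging the domination bound over disjoint `k`-subsets of an independent set of size `r * k`:
`w v` counts the blocks that dominate `v`. -/
theorem exists_domination_weight {V : Type*} [Fintype V] {G : SimpleGraph V} [DecidableRel G.Adj]
    {k n r : ℕ} (hG : ¬ HasCopy Gᶜ (Book k n)) {S : Finset V}
    (hS : S.card = r * k) (hind : G.IsIndepSet (S : Set V)) :
    ∃ w : V → ℕ, (∀ v, w v ≤ r) ∧ (∀ v, w v ≤ (S.filter fun u => G.Adj u v).card) ∧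
      r * (Fintype.card V + 1) ≤ ∑ v, w v + r * n := by
  classical
  obtain ⟨B, hBS, hBc, hBd⟩ := exists_disjoint_blocks S hS
  refine ⟨fun v => (univ.filter fun b => ∃ u ∈ B b, G.Adj u v).card, fun v => ?_, fun v => ?_, ?_⟩
  · simpa using card_filter_le (univ : Finset (Fin r)) (fun b => ∃ u ∈ B b, G.Adj u v)
  · have hex : ∀ b, ∃ u, (∃ u ∈ B b, G.Adj u v) → u ∈ B b ∧ G.Adj u v := fun b => by
      by_cases h : ∃ u ∈ B b, G.Adj u v
      · exact ⟨h.choose, fun _ => h.choose_spec⟩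
      · exact ⟨v, fun h' => absurd h' h⟩
    choose f hf using hex
    refine card_le_card_of_injOn f ?_ ?_
    · intro b hb
      have := hf b (mem_filter.1 hb).2
      exact mem_filter.2 ⟨hBS b this.1, this.2⟩
    · intro b hb c hc hbc
      by_contra hne
      have h1 := (hf b (mem_filter.1 hb).2).1
      have h2 := (hf c (mem_filter.1 hc).2).1
      exact Finset.disjoint_left.1 (hBd b c hne) h1 (hbc ▸ h2)
  · have hswap : ∑ v, (univ.filter fun b => ∃ u ∈ B b, G.Adj u v).card =
        ∑ b, (univ.filter fun v => ∃ u ∈ B b, G.Adj u v).card := by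
      simp only [card_filter]
      exact sum_comm
    have hb : ∑ _b : Fin r, (Fintype.card V + 1) ≤
        ∑ b, ((univ.filter fun v => ∃ u ∈ B b, G.Adj u v).card + n) :=
      sum_le_sum fun b _ => card_le_card_dominated hG (hBc b)
        (hind.mono (coe_subset.2 (hBS b)))
    rw [hswap]
    simpa [sum_add_distrib] using hb

open Finset in
/-- A clique on `p * t` vertices contains `K_p(1,1,t,…,t)`. -/
theorem hasCopy_kMulti_of_isClique {V : Type*} {G : SimpleGraph V} {p t : ℕ} (ht : 1 ≤ t)
    {C : Finset V} (hC : C.card = p * t) (hcl : G.IsClique (C : Set V)) :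
    HasCopy G (KMulti fun i : Fin p => if (i : ℕ) < 2 then 1 else t) := by
  classical
  obtain ⟨B, hBC, hBc, hBd⟩ := exists_disjoint_blocks C hC
  refine hasCopy_kMulti_of_sets B (fun i => ?_) fun i j hij x hx y hy => ?_
  · rw [hBc]
    split_ifs <;> omega
  · refine hcl (hBC i hx) (hBC j hy) ?_
    rintro rfl
    exact Finset.disjoint_left.1 (hBd i j hij) hx hy

open Finset in
/-- Extracting from `q` completely joined independent sets and a large set of vertices with many
neighbours in each of them a family of `q + 1` completely joined independent sets. -/
theorem exists_indep_family_succ {V : Type*} {G : SimpleGraph V} [DecidableRel G.Adj]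
    {q s h c : ℕ} {S : Fin q → Finset V} (hS : ∀ i, (S i).card = s)
    (hind : ∀ i, G.IsIndepSet (S i : Set V))
    (hjoin : ∀ i j, i ≠ j → ∀ x ∈ S i, ∀ y ∈ S j, G.Adj x y)
    (hcl : ∀ C : Finset V, C.card = c → ¬ G.IsClique (C : Set V))
    {M : Finset V} (hM : ∀ v ∈ M, ∀ i, h ≤ ((S i).filter fun u => G.Adj u v).card)
    (hcard : 2 ^ (s * q) * 2 ^ (c + h) ≤ M.card) :
    ∃ S' : Fin (q + 1) → Finset V, (∀ i, (S' i).card = h) ∧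
      (∀ i, G.IsIndepSet (S' i : Set V)) ∧
      ∀ i j, i ≠ j → ∀ x ∈ S' i, ∀ y ∈ S' j, G.Adj x y := by
  classical
  let f : V → Fin q → Finset V := fun v i => (S i).filter fun u => G.Adj u v
  have hcardT : (Fintype.piFinset fun i => (S i).powerset).card = 2 ^ (s * q) := by
    simp [hS, pow_mul]
  obtain ⟨P, -, hP⟩ := exists_le_card_fiber_of_mul_le_card_of_maps_to (s := M) (f := f)
    (t := Fintype.piFinset fun i => (S i).powerset) (n := 2 ^ (c + h))
    (fun v _ => by simp [f]) ⟨fun _ => ∅, by simp⟩ (by rw [hcardT]; exact hcard)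
  obtain ⟨v, hv⟩ : (M.filter fun v => f v = P).Nonempty := by
    rw [← card_pos]
    exact lt_of_lt_of_le (by positivity) hP
  rw [mem_filter] at hv
  have hPh : ∀ i, h ≤ (P i).card := fun i => hv.2 ▸ hM v hv.1 i
  choose R hRP hRc using fun i => exists_subset_card_eq (hPh i)
  have hRS : ∀ i, R i ⊆ S i := fun i x hx => by
    have := hRP i hx
    rw [← hv.2] at this
    exact (mem_filter.1 this).1
  rcases exists_isNClique_or_isIndepSet G c h _ hP with ⟨C, -, hC, hC'⟩ | ⟨I, hI, hIc, hIi⟩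
  · exact absurd hC' (hcl C hC)
  have hIR : ∀ i, ∀ x ∈ I, ∀ y ∈ R i, G.Adj x y := fun i x hx y hy => by
    have h1 := hRP i hy
    rw [← (mem_filter.1 (hI hx)).2] at h1
    exact (mem_filter.1 h1).2.symm
  refine ⟨Fin.cons I R, Fin.cases hIc hRc,
    Fin.cases hIi fun i => (hind i).mono (coe_subset.2 (hRS i)), ?_⟩
  refine Fin.cases (Fin.cases (fun h => absurd rfl h) fun j _ => hIR j) fun i =>
    Fin.cases (fun _ x hx y hy => (hIR i y hy x hx).symm) fun j hij x hx y hy => ?_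
  exact hjoin i j (fun h => hij (h ▸ rfl)) x (hRS i hx) y (hRS j hy)

open Finset in
/-- Many vertices have at least `h` neighbours in each of `q` independent sets, if `q` is small. -/
theorem le_two_mul_card_attached {V : Type*} [Fintype V] {G : SimpleGraph V} [DecidableRel G.Adj]
    {k n p q r h : ℕ} (hG : ¬ HasCopy Gᶜ (Book k n)) (hn : 1 ≤ n)
    (hV : Fintype.card V = (p - 1) * (n - 1) + 1) (hq : q + 1 ≤ p - 1) (hr : 1 ≤ r)
    (hh : 2 * p * h ≤ r) {S : Fin q → Finset V} (hS : ∀ i, (S i).card = r * k)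
    (hind : ∀ i, G.IsIndepSet (S i : Set V)) :
    n ≤ 2 * (univ.filter fun v => ∀ i, h ≤ ((S i).filter fun u => G.Adj u v).card).card := by
  classical
  set M := univ.filter fun v => ∀ i, h ≤ ((S i).filter fun u => G.Adj u v).card with hMdef
  choose w hwr hwd hws using fun i => exists_domination_weight hG (hS i) (hind i)
  have hpt : ∀ v, ∑ i, w i v + r ≤ (q * r + h) + if v ∈ M then r else 0 := by
    intro v
    by_cases hv : v ∈ M
    · have : ∑ i, w i v ≤ ∑ _i : Fin q, r := sum_le_sum fun i _ => hwr i v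
      simp only [sum_const, card_univ, Fintype.card_fin, smul_eq_mul] at this
      simp only [hv, if_true]
      omega
    · obtain ⟨i, hi⟩ : ∃ i, ((S i).filter fun u => G.Adj u v).card < h := by
        simpa [hMdef] using hv
      have h1 : ∑ j ∈ univ.erase i, w j v ≤ ∑ _j ∈ univ.erase i, r :=
        sum_le_sum fun j _ => hwr j v
      have h2 := add_sum_erase univ (fun j => w j v) (mem_univ i)
      have h3 := add_sum_erase univ (fun _ : Fin q => r) (mem_univ i)
      simp only [sum_const (s := (univ : Finset (Fin q))), card_univ, Fintype.card_fin,
        smul_eq_mul] at h3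
      have h4 := hwd i v
      simp only [hv, if_false]
      omega
  have hsum := sum_le_sum fun v (_ : v ∈ (univ : Finset V)) => hpt v
  have hlow := sum_le_sum fun i (_ : i ∈ (univ : Finset (Fin q))) => hws i
  rw [sum_add_distrib, sum_comm] at hlow
  simp only [sum_add_distrib, sum_const, card_univ, Fintype.card_fin, smul_eq_mul,
    sum_ite_mem, univ_inter] at hsum hlow
  generalize (∑ v, ∑ i, w i v) = σ at hsum hlow
  obtain ⟨m, rfl⟩ := Nat.exists_eq_add_of_le' hn
  obtain ⟨d, hd⟩ := Nat.exists_eq_add_of_le hq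
  have hp : p = q + 2 + d := by omega
  subst hp
  rw [hd, Nat.add_sub_cancel] at hV
  have h1 : r * (m + 1) ≤ Fintype.card V * h + M.card * r := by
    have : r * (m + 1) + q * r * (m + 1) ≤ q * r + Fintype.card V * r := by
      rw [hV]
      nlinarith [Nat.zero_le (d * m * r)]
    nlinarith
  have h2 : 2 * (Fintype.card V * h) ≤ r * (m + 1) := by
    have : Fintype.card V ≤ (q + 2 + d) * (m + 1) := by
      rw [hV]
      nlinarith
    calc 2 * (Fintype.card V * h) ≤ 2 * ((q + 2 + d) * (m + 1) * h) := by gcongr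
      _ = 2 * (q + 2 + d) * h * (m + 1) := by ring
      _ ≤ r * (m + 1) := by gcongr
  have h3 : r * (m + 1) ≤ r * (2 * M.card) := by linarith
  exact Nat.le_of_mul_le_mul_left h3 hr

open Finset in
/-- If the complement of `G` contains no book and `G` contains no large clique, then `G` contains
`p - 1` completely joined independent sets of logarithmic size. -/
theorem exists_indep_family (k p : ℕ) (hk : 1 ≤ k) (q : ℕ) (hq : q ≤ p - 1) :
    ∀ c : ℕ, 1 ≤ c → ∃ K : ℕ, ∀ (t n : ℕ), 1 ≤ t → 2 ^ (K * t) ≤ n →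
      ∀ {V : Type} [Fintype V] (G : SimpleGraph V),
        Fintype.card V = (p - 1) * (n - 1) + 1 → ¬ HasCopy Gᶜ (Book k n) →
        (∀ C : Finset V, C.card = p * t → ¬ G.IsClique (C : Set V)) →
        ∃ S : Fin q → Finset V, (∀ i, (S i).card = c * t * k) ∧
          (∀ i, G.IsIndepSet (S i : Set V)) ∧
          ∀ i j, i ≠ j → ∀ x ∈ S i, ∀ y ∈ S j, G.Adj x y := by
  classical
  induction q with
  | zero => exact fun c _ => ⟨0, fun t n _ _ V _ G _ _ _ => ⟨fun _ => ∅, fun i => i.elim0,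
      fun i => i.elim0, fun i => i.elim0⟩⟩
  | succ q ih =>
    intro c hc
    have hp : 0 < p := by omega
    obtain ⟨K, hK⟩ := ih (by omega) (2 * p * (c * k)) (Nat.mul_pos (by omega) (Nat.mul_pos hc hk))
    refine ⟨K + (2 * p * (c * k) * k * q + (p + c * k)) + 1, fun t n ht hn V _ G hV hG hcl => ?_⟩
    have hn' : 2 ^ (K * t) ≤ n := by
      refine le_trans (Nat.pow_le_pow_right (by norm_num) (Nat.mul_le_mul_right t ?_)) hn
      omega
    obtain ⟨S, hSc, hSi, hSj⟩ := hK t n ht hn' G hV hG hcl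
    have hn1 : 1 ≤ n := le_trans Nat.one_le_two_pow hn
    have hM := le_two_mul_card_attached (h := c * t * k) hG hn1 hV hq
      (Nat.mul_pos (Nat.mul_pos (by omega) (Nat.mul_pos hc hk)) ht) (le_of_eq (by ring)) hSc hSi
    refine exists_indep_family_succ (M := univ.filter fun v =>
      ∀ i, c * t * k ≤ ((S i).filter fun u => G.Adj u v).card) hSc hSi hSj hcl (fun v hv => (mem_filter.1 hv).2) ?_
    have hpow : 2 * (2 ^ (2 * p * (c * k) * t * k * q) * 2 ^ (p * t + c * t * k)) ≤ n := by
      refine le_trans ?_ hn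
      rw [← pow_add, ← pow_succ']
      refine Nat.pow_le_pow_right (by norm_num) ?_
      nlinarith [Nat.zero_le (K * t)]
    omega

open Finset in
/-- The upper bound on the Ramsey number. -/
theorem hasCopy_or_hasCopy_compl (k p : ℕ) (hk : 1 ≤ k) (hp : 2 ≤ p) :
    ∃ K : ℕ, ∀ (t n : ℕ), 1 ≤ t → 2 ^ (K * t) ≤ n →
      ∀ {V : Type} [Fintype V] (G : SimpleGraph V),
        Fintype.card V = (p - 1) * (n - 1) + 1 →
        HasCopy G (KMulti fun i : Fin p => if (i : ℕ) < 2 then 1 else t) ∨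
          HasCopy Gᶜ (Book k n) := by
  classical
  obtain ⟨Q, rfl⟩ := Nat.exists_eq_add_of_le' hp
  obtain ⟨K, hK⟩ := exists_indep_family k (Q + 2) hk (Q + 1) le_rfl 2 (by norm_num)
  refine ⟨K, fun t n ht hn V _ G hV => ?_⟩
  by_contra! hcon
  obtain ⟨hG, hB⟩ := hcon
  obtain ⟨S, hSc, hSi, hSj⟩ := hK t n ht hn G hV hB
    fun C hC hcl => hG (hasCopy_kMulti_of_isClique ht hC hcl)
  have hn1 : 1 ≤ n := le_trans Nat.one_le_two_pow hn
  choose w hwr hwd hws using fun i => exists_domination_weight hB (hSc i) (hSi i)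
  have hpt : ∀ v, ∑ i, w i v ≤ Q * (2 * t) := by
    intro v
    by_cases hzero : ∃ i, w i v = 0
    · obtain ⟨i, hi⟩ := hzero
      rw [Fin.sum_univ_succAbove _ i, hi, zero_add]
      simpa using sum_le_sum fun j (_ : j ∈ univ) => hwr (i.succAbove j) v
    push Not at hzero
    by_cases hlow : ∃ i j, i ≠ j ∧ w i v ≤ t ∧ w j v ≤ t
    · obtain ⟨i, j, hij, hi, hj⟩ := hlow
      obtain ⟨l, rfl⟩ := Fin.exists_succAbove_eq hij.symm
      obtain ⟨Q, rfl⟩ : ∃ Q', Q = Q' + 1 := ⟨Q - 1, by have := l.pos; omega⟩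
      rw [Fin.sum_univ_succAbove _ i, Fin.sum_univ_succAbove _ l]
      have : ∑ j : Fin Q, w (i.succAbove (l.succAbove j)) v ≤ ∑ _j : Fin Q, 2 * t :=
        sum_le_sum fun j _ => hwr _ v
      simp only [sum_const, card_univ, Fintype.card_fin, smul_eq_mul] at this
      linarith
    exfalso
    push Not at hlow
    obtain ⟨i, hi⟩ : ∃ i, ∀ j, j ≠ i → t ≤ w j v := by
      by_cases h : ∃ i, w i v ≤ t
      · exact ⟨h.choose, fun j hj => (hlow _ j hj.symm h.choose_spec).le⟩
      · push Not at h
        exact ⟨0, fun j _ => (h j).le⟩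
    obtain ⟨z, hz⟩ : ((S i).filter fun u => G.Adj u v).Nonempty :=
      card_pos.1 (lt_of_lt_of_le (Nat.pos_of_ne_zero (hzero i)) (hwd i v))
    rw [mem_filter] at hz
    apply hG
    let N : Fin Q → Finset V := fun j => (S (i.succAbove j)).filter fun u => G.Adj u v
    have hvN : ∀ j, ∀ y ∈ N j, G.Adj v y := fun j y hy => (mem_filter.1 hy).2.symm
    have hzN : ∀ j, ∀ y ∈ N j, G.Adj z y := fun j y hy =>
      hSj _ _ (Fin.succAbove_ne i j).symm z hz.1 y (mem_filter.1 hy).1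
    refine hasCopy_kMulti_of_sets (Fin.cons {v} (Fin.cons {z} N) : Fin (Q + 2) → Finset V) ?_ ?_
    · refine Fin.cases (by simp) (Fin.cases (by simp) fun j => ?_)
      simpa [N] using (hi _ (Fin.succAbove_ne i j)).trans (hwd _ v)
    · refine Fin.cases (Fin.cases (by simp) (Fin.cases ?_ fun j => ?_))
        (Fin.cases (Fin.cases ?_ (Fin.cases (by simp) fun j => ?_))
          fun j => Fin.cases ?_ (Fin.cases ?_ fun l => ?_))
      · simpa using hz.2.symm
      · simpa using fun _ => hvN j
      · simpa using hz.2
      · simpa using fun x hx => (hvN j x hx).symm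
      · simpa using fun _ => hzN j
      · simpa using fun _ x hx => (hzN j x hx).symm
      · intro hjl x hx y hy
        refine hSj _ _ (fun h => hjl ?_) x (mem_filter.1 hx).1 y (mem_filter.1 hy).1
        have hjl' : j = l := Fin.succAbove_right_injective h
        rw [hjl']
  have hsum := sum_le_sum fun v (_ : v ∈ (univ : Finset V)) => hpt v
  have hlow := sum_le_sum fun i (_ : i ∈ (univ : Finset (Fin (Q + 1)))) => hws i
  rw [sum_add_distrib, sum_comm] at hlow
  simp only [sum_const, card_univ, Fintype.card_fin, smul_eq_mul] at hsum hlow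
  obtain ⟨m, rfl⟩ := Nat.exists_eq_add_of_le' hn1
  have hV' : Fintype.card V = (Q + 1) * m + 1 := hV
  have h : 2 * t * ((Q + 1) * (Fintype.card V + 1)) ≤
      2 * t * (Fintype.card V * Q + (Q + 1) * (m + 1)) := by linarith
  have h' := Nat.le_of_mul_le_mul_left h (by omega)
  rw [hV'] at h'
  nlinarith

open Finset in
/-- The lower bound on the Ramsey number, from a complete multipartite graph. -/
theorem exists_not_hasCopy {k p n N : ℕ} (hk : 1 ≤ k) (hkn : k ≤ n) (hn : 2 ≤ n)
    (hN : N ≤ (p - 1) * (n - 1)) (hp : 1 ≤ p) {a : Fin p → ℕ}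
    (ha : ∀ i, 1 ≤ a i) :
    ∃ G : SimpleGraph (Fin N), ¬ HasCopy G (KMulti a) ∧ ¬ HasCopy Gᶜ (Book k n) := by
  classical
  refine ⟨(⊤ : SimpleGraph ℕ).comap fun x : Fin N => (x : ℕ) / (n - 1), ?_, ?_⟩
  · rintro ⟨f, -⟩
    let g : Fin p → ℕ := fun i => (f ⟨i, ⟨0, ha i⟩⟩ : ℕ) / (n - 1)
    have hg : ∀ i ∈ univ, g i ∈ range (p - 1) := fun i _ => by
      rw [mem_range]
      exact Nat.div_lt_of_lt_mul (by rw [mul_comm]; exact (f _).2.trans_le hN)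
    obtain ⟨i, -, j, -, hij, h⟩ := exists_ne_map_eq_of_card_lt_of_maps_to
      (by simpa using Nat.lt_of_lt_of_le Nat.zero_lt_one hp) hg
    have : (KMulti a).Adj ⟨i, ⟨0, ha i⟩⟩ ⟨j, ⟨0, ha j⟩⟩ := hij
    exact f.map_rel this h
  · rintro ⟨f, hf⟩
    let c : Σ i : Fin (k + 1), Fin (if (i : ℕ) < k then 1 else n - k) :=
      ⟨0, ⟨0, by simp [show 0 < k by omega]⟩⟩
    have hsame : ∀ v, (f v : ℕ) / (n - 1) = (f c : ℕ) / (n - 1) := by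
      intro v
      by_cases hv : v = c
      · rw [hv]
      have hadj : (Book k n).Adj v c := by
        intro h
        apply hv
        obtain ⟨i, x⟩ := v
        obtain rfl : i = 0 := h
        have hx := x.2
        have : (x : ℕ) = 0 := by
          simp only [Fin.val_zero, show 0 < k by omega, if_true] at hx
          omega
        exact congrArg _ (Fin.ext this)
      have := (f.map_rel hadj).2
      simpa using this
    have hcard : Fintype.card (Σ i : Fin (k + 1), Fin (if (i : ℕ) < k then 1 else n - k)) = n := by
      rw [Fintype.card_sigma, Fin.sum_univ_castSucc]
      simp
      omega
    have hle : (univ : Finset (Σ i : Fin (k + 1), Fin (if (i : ℕ) < k then 1 else n - k))).card ≤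
        (range (n - 1)).card := by
      refine card_le_card_of_injOn (fun v => (f v : ℕ) % (n - 1)) ?_ ?_
      · intro v _
        simpa using Nat.mod_lt _ (by omega)
      · intro u _ v _ huv
        apply hf
        apply Fin.ext
        rw [← Nat.div_add_mod (f u : ℕ) (n - 1), ← Nat.div_add_mod (f v : ℕ) (n - 1), hsame u,
          hsame v]
        exact congrArg _ huv
    rw [card_univ, hcard, card_range] at hle
    omega

/-- Logarithmic part sizes satisfy the exponential size condition. -/
theorem exists_delta (K : ℕ) : ∃ δ : ℝ, 0 < δ ∧ ∃ n₀ : ℕ, ∀ n : ℕ, n₀ ≤ n →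
    1 ≤ ⌈δ * Real.log n⌉₊ ∧ 2 ^ (K * ⌈δ * Real.log n⌉₊) ≤ n := by
  refine ⟨1 / (2 * (K + 1)), by positivity, 4 ^ (K + 1), fun n hn => ?_⟩
  have hn' : (4 : ℝ) ^ (K + 1) ≤ n := by exact_mod_cast hn
  have h4 : (4 : ℝ) ≤ 4 ^ (K + 1) := le_self_pow₀ (by norm_num) (by omega)
  have hnpos : (0 : ℝ) < n := by linarith
  have hlog : 0 < Real.log n := Real.log_pos (by linarith)
  have hδ : 0 < 1 / (2 * ((K : ℝ) + 1)) * Real.log n := by positivity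
  refine ⟨Nat.one_le_ceil_iff.2 hδ, ?_⟩
  have hceil := (Nat.ceil_lt_add_one hδ.le).le
  set t := ⌈1 / (2 * ((K : ℝ) + 1)) * Real.log n⌉₊
  have hlog2 : Real.log 2 ≤ 1 := by linarith [Real.log_two_lt_d9]
  have hlog2' : 0 < Real.log 2 := Real.log_pos (by norm_num)
  have hlogn : 2 * (K + 1) * Real.log 2 ≤ Real.log n := by
    have h := Real.log_le_log (by positivity) hn'
    rw [Real.log_pow, show (4 : ℝ) = 2 ^ 2 by norm_num, Real.log_pow] at h
    push_cast at h
    linarith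
  have hreal : (2 : ℝ) ^ (K * t) ≤ n := by
    rw [← Real.log_le_log_iff (by positivity) hnpos, Real.log_pow]
    push_cast
    have hKt : (K : ℝ) * t ≤ Real.log n / 2 + K := by
      have h1 : (K : ℝ) * t ≤ K * (1 / (2 * ((K : ℝ) + 1)) * Real.log n + 1) := by gcongr
      have h2 : (K : ℝ) * (1 / (2 * ((K : ℝ) + 1))) ≤ 1 / 2 := by
        rw [mul_one_div, div_le_div_iff₀ (by positivity) (by norm_num)]
        linarith
      nlinarith
    nlinarith
  exact_mod_cast hreal

/-- Corollary 1.7 (Nikiforov–Rousseau): for every `k ≥ 1`, `p ≥ 2` there are `δ > 0` and `n₀`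
such that for all `n ≥ n₀`,
`r(K_p(1,1,⌈δ ln n⌉,…,⌈δ ln n⌉), B_{k,n}) = (p-1)(n-1) + 1`. -/
theorem ramsey_book_two_singletons (k p : ℕ) (hk : 1 ≤ k) (hp : 2 ≤ p) :
    ∃ δ : ℝ, 0 < δ ∧ ∃ n₀ : ℕ, ∀ n : ℕ, n₀ ≤ n →
      ramseyNumber
        (KMulti (fun i : Fin p => if (i : ℕ) < 2 then 1 else ⌈δ * Real.log n⌉₊))
        (Book k n) = (p - 1) * (n - 1) + 1 := by
  obtain ⟨K, hK⟩ := hasCopy_or_hasCopy_compl k p hk hp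
  obtain ⟨δ, hδ, n₀, hn₀⟩ := exists_delta K
  refine ⟨δ, hδ, max n₀ (k + 2), fun n hn => ?_⟩
  obtain ⟨ht, hKt⟩ := hn₀ n (le_trans (le_max_left _ _) hn)
  have hn2 : k + 2 ≤ n := le_trans (le_max_right _ _) hn
  have hmem : (p - 1) * (n - 1) + 1 ∈ {N : ℕ | ∀ G : SimpleGraph (Fin N),
      HasCopy G (KMulti (fun i : Fin p => if (i : ℕ) < 2 then 1 else ⌈δ * Real.log n⌉₊)) ∨
        HasCopy Gᶜ (Book k n)} :=
    fun G => hK _ n ht hKt G (Fintype.card_fin _)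
  refine le_antisymm (Nat.sInf_le hmem) (le_csInf ⟨_, hmem⟩ fun N hN => ?_)
  by_contra! hlt
  obtain ⟨G, hG₁, hG₂⟩ := exists_not_hasCopy hk (by omega) (by omega) (Nat.lt_succ_iff.1 hlt)
    (by omega)
    (a := fun i : Fin p => if (i : ℕ) < 2 then 1 else ⌈δ * Real.log n⌉₊)
    (fun i => by split_ifs <;> omega)
  exact (hN G).elim hG₁ hG₂
end

section
/- For all integers p ≥ 2, k ≥ 1, n ≥ k+1 and all positive integers a₁ ≤ a₂ ≤ ⋯ ≤ a_p, the Ramsey number satisfies r(K_p(a₁,…,a_p), B_{k,n}) > (p−1)(n−1) + d_k(n, K_{a₁,a₂}). -/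
open SimpleGraph

/-- The Dirac-type extremal function `d_k(n, H)`: the maximum `d` for which there is an
`(n + d - 1)`-vertex `H`-free graph in which at most `k - 1` vertices have degree less
than `d`. -/
noncomputable def dirac {W : Type*} (H : SimpleGraph W) (k n : ℕ) : ℕ :=
  sSup {d : ℕ | ∃ G : SimpleGraph (Fin (n + d - 1)), ¬ HasCopy G H ∧
    {v : Fin (n + d - 1) | (G.neighborSet v).ncard < d}.ncard ≤ k - 1}

theorem HasCopy.trans {U V W : Type*} {G : SimpleGraph U} {H : SimpleGraph V}
    {K : SimpleGraph W} (h₁ : HasCopy G H) (h₂ : HasCopy H K) : HasCopy G K := by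
  obtain ⟨f, hf⟩ := h₁
  obtain ⟨g, hg⟩ := h₂
  exact ⟨f.comp g, hf.comp hg⟩

/-- Ramsey's theorem for graphs, relative to a finite set of vertices. -/
theorem exists_clique_or_compl_clique (s t : ℕ) :
    ∃ N : ℕ, ∀ (V : Type) (G : SimpleGraph V) (S : Finset V), N ≤ S.card →
      ∃ A ⊆ S, G.IsNClique s A ∨ Gᶜ.IsNClique t A := by
  classical
  induction s generalizing t with
  | zero => exact ⟨0, fun V G S _ => ⟨∅, by simp, Or.inl (by simp [isNClique_iff])⟩⟩
  | succ s ihs =>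
    induction t with
    | zero => exact ⟨0, fun V G S _ => ⟨∅, by simp, Or.inr (by simp [isNClique_iff])⟩⟩
    | succ t iht =>
      obtain ⟨N₁, h₁⟩ := ihs (t + 1)
      obtain ⟨N₂, h₂⟩ := iht
      refine ⟨N₁ + N₂ + 1, fun V G S hS => ?_⟩
      obtain ⟨v, hv⟩ : S.Nonempty := Finset.card_pos.mp (by omega)
      have hcard := Finset.card_filter_add_card_filter_not (s := S.erase v) (fun w => G.Adj v w)
      rw [Finset.card_erase_of_mem hv] at hcard
      by_cases hN : N₁ ≤ ((S.erase v).filter fun w => G.Adj v w).card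
      · obtain ⟨A, hAS, hA⟩ := h₁ V G _ hN
        have hsub : A ⊆ S := fun x hx =>
          Finset.mem_of_mem_erase (Finset.mem_filter.mp (hAS hx)).1
        rcases hA with hA | hA
        · refine ⟨insert v A, Finset.insert_subset hv hsub, Or.inl (hA.insert fun w hw => ?_)⟩
          exact (Finset.mem_filter.mp (hAS hw)).2
        · exact ⟨A, hsub, Or.inr hA⟩
      · obtain ⟨A, hAS, hA⟩ := h₂ V G ((S.erase v).filter fun w => ¬ G.Adj v w) (by omega)
        have hsub : A ⊆ S := fun x hx =>
          Finset.mem_of_mem_erase (Finset.mem_filter.mp (hAS hx)).1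
        rcases hA with hA | hA
        · exact ⟨A, hsub, Or.inl hA⟩
        · refine ⟨insert v A, Finset.insert_subset hv hsub, Or.inr (hA.insert fun w hw => ?_)⟩
          have hw' := Finset.mem_filter.mp (hAS hw)
          exact ⟨(Finset.ne_of_mem_erase hw'.1).symm, hw'.2⟩

theorem hasCopy_of_isNClique {V W : Type*} [Fintype W] {G : SimpleGraph V} (H : SimpleGraph W)
    {A : Finset V} (hA : G.IsNClique (Fintype.card W) A) : HasCopy G H := by
  have e : W ≃ A := Fintype.equivOfCardEq (by simp [hA.card_eq])
  have he : Function.Injective fun w => (e w : V) := Subtype.val_injective.comp e.injective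
  exact ⟨⟨fun w => e w, fun {u v} h => hA.isClique (e u).2 (e v).2 (he.ne h.ne)⟩, he⟩

theorem exists_ramsey_bound {V W : Type*} [Fintype V] [Fintype W] (H₁ : SimpleGraph V)
    (H₂ : SimpleGraph W) : ∃ N, ∀ G : SimpleGraph (Fin N), HasCopy G H₁ ∨ HasCopy Gᶜ H₂ := by
  obtain ⟨N, hN⟩ := exists_clique_or_compl_clique (Fintype.card V) (Fintype.card W)
  refine ⟨N, fun G => ?_⟩
  obtain ⟨A, -, hA⟩ := hN _ G Finset.univ (by simp)
  exact hA.imp (hasCopy_of_isNClique H₁) (hasCopy_of_isNClique H₂)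

/-- A graph witnessing the failure of the Ramsey property bounds the Ramsey number from below. -/
theorem card_lt_ramseyNumber {U V W : Type*} [Fintype U] [Fintype V] [Fintype W]
    {H₁ : SimpleGraph V} {H₂ : SimpleGraph W} (G : SimpleGraph U) (h₁ : ¬ HasCopy G H₁)
    (h₂ : ¬ HasCopy Gᶜ H₂) : Fintype.card U < ramseyNumber H₁ H₂ := by
  by_contra! hle
  have hmem := Nat.sInf_mem (exists_ramsey_bound H₁ H₂)
  obtain ⟨e⟩ : Nonempty (Fin (ramseyNumber H₁ H₂) ↪ U) :=
    Function.Embedding.nonempty_of_card_le (by simpa using hle)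
  rcases hmem (G.comap e) with h | h
  · exact h₁ (HasCopy.trans ⟨⟨e, fun h => h⟩, e.injective⟩ h)
  · let f : (G.comap e)ᶜ →g Gᶜ :=
      ⟨e, fun {u v} (h : (G.comap e)ᶜ.Adj u v) => ⟨e.injective.ne h.1, h.2⟩⟩
    exact h₂ (HasCopy.trans ⟨f, e.injective⟩ h)

theorem hasCopy_KMulti {p q : ℕ} {a : Fin p → ℕ} {b : Fin q → ℕ} (g : Fin q → Fin p)
    (hg : Function.Injective g) (hab : ∀ i, b i ≤ a (g i)) : HasCopy (KMulti a) (KMulti b) := by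
  refine ⟨⟨fun x => ⟨g x.1, Fin.castLE (hab x.1) x.2⟩, fun h => hg.ne h⟩, ?_⟩
  rintro ⟨i, x⟩ ⟨j, y⟩ h
  obtain ⟨h₁, h₂⟩ := Sigma.mk.inj h
  obtain rfl := hg h₁
  simpa using h₂

/-- The supremum defining `dirac` is attained. -/
theorem dirac_spec {W : Type*} {H : SimpleGraph W} {u v : W} (huv : H.Adj u v) (k n : ℕ) :
    ∃ G : SimpleGraph (Fin (n + dirac H k n - 1)), ¬ HasCopy G H ∧
      {v : Fin (n + dirac H k n - 1) | (G.neighborSet v).ncard < dirac H k n}.ncard ≤ k - 1 := by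
  let S : Set ℕ := {d : ℕ | ∃ G : SimpleGraph (Fin (n + d - 1)), ¬ HasCopy G H ∧
    {v : Fin (n + d - 1) | (G.neighborSet v).ncard < d}.ncard ≤ k - 1}
  have h0 : 0 ∈ S := ⟨⊥, fun ⟨f, _⟩ => f.map_adj huv, by simp⟩
  change sSup S ∈ S
  by_cases hS : BddAbove S
  · exact Nat.sSup_mem ⟨0, h0⟩ hS
  · rwa [csSup_of_not_bddAbove hS, csSup_empty]

/-- The join of `G` with `q` independent sets of size `m`. -/
def joinIndep {V : Type*} (G : SimpleGraph V) (q m : ℕ) :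
    SimpleGraph (V ⊕ (Fin q × Fin m)) where
  Adj
    | .inl x, .inl y => G.Adj x y
    | .inr x, .inr y => x.1 ≠ y.1
    | _, _ => True
  symm := ⟨by
    rintro (x | x) (y | y) h
    · exact SimpleGraph.Adj.symm h
    · trivial
    · trivial
    · exact Ne.symm h⟩
  loopless := ⟨by
    rintro (x | x) h
    · exact G.irrefl h
    · exact h rfl⟩

theorem not_hasCopy_joinIndep {V : Type*} {G : SimpleGraph V} {p : ℕ} (hp : 2 ≤ p) (m : ℕ)
    {a : Fin p → ℕ} (hmono : Monotone a)
    (hG : ¬ HasCopy G (KMulti ![a ⟨0, by omega⟩, a ⟨1, by omega⟩])) :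
    ¬ HasCopy (joinIndep G (p - 2) m) (KMulti a) := by
  classical
  rintro ⟨f, hf⟩
  let bad : Finset (Fin p) := Finset.univ.filter fun i => ∃ x c, f ⟨i, x⟩ = Sum.inr c
  have hbad : ∀ i : bad, ∃ x c, f ⟨i, x⟩ = Sum.inr c := fun i => (Finset.mem_filter.mp i.2).2
  choose x c hc using hbad
  have hinj : Function.Injective fun i => (c i).1 := by
    intro i j hij
    by_contra hne
    have hadj : (KMulti a).Adj ⟨i, x i⟩ ⟨j, x j⟩ := fun h => hne (Subtype.ext h)
    have := f.map_adj hadj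
    rw [hc, hc] at this
    exact this hij
  have hcard := Fintype.card_le_of_injective _ hinj
  have hgood : 1 < badᶜ.card := by
    rw [Finset.card_compl]
    simp only [Fintype.card_coe, Fintype.card_fin] at hcard ⊢
    omega
  obtain ⟨i, hi, j, hj, hij⟩ : ∃ i ∈ badᶜ, ∃ j ∈ badᶜ, i < j := by
    obtain ⟨i, hi, j, hj, hne⟩ := Finset.one_lt_card.mp hgood
    rcases lt_or_gt_of_ne hne with h | h
    exacts [⟨i, hi, j, hj, h⟩, ⟨j, hj, i, hi, h⟩]
  have hinl : ∀ i ∈ badᶜ, ∀ y, ∃ v, f ⟨i, y⟩ = Sum.inl v := by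
    intro i hi y
    rcases h : f ⟨i, y⟩ with v | c
    · exact ⟨v, rfl⟩
    · exact absurd (Finset.mem_filter.mpr ⟨Finset.mem_univ i, y, c, h⟩) (Finset.mem_compl.mp hi)
  have hpair : HasCopy G (KMulti ![a i, a j]) := by
    obtain ⟨g, hg⟩ : ∃ g : KMulti ![a i, a j] →g KMulti a, Function.Injective g ∧
        ∀ z, (g z).1 ∈ badᶜ := by
      let e : Fin 2 → Fin p := ![i, j]
      have he : ∀ l, ![a i, a j] l = a (e l) := by
        intro l
        fin_cases l <;> rfl
      have hmem : ∀ l, e l ∈ badᶜ := by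
        intro l
        fin_cases l
        exacts [hi, hj]
      have heinj : Function.Injective e := by
        intro l l'
        fin_cases l <;> fin_cases l' <;> simp [e, hij.ne, hij.ne']
      refine ⟨⟨fun z => ⟨e z.1, Fin.cast (he z.1) z.2⟩, fun h => heinj.ne h⟩, ?_, fun z => hmem _⟩
      rintro ⟨l, y⟩ ⟨l', y'⟩ h
      obtain ⟨h₁, h₂⟩ := Sigma.mk.inj h
      obtain rfl := heinj h₁
      simpa using h₂
    choose φ hφ using fun z => hinl _ (hg.2 z) (g z).2
    refine ⟨⟨φ, fun {z w} hzw => ?_⟩, fun z w hzw => ?_⟩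
    · have := f.map_adj (g.map_adj hzw)
      rw [hφ z, hφ w] at this
      exact this
    · apply hg.1
      apply hf
      rw [hφ z, hφ w]
      exact congrArg Sum.inl hzw
  refine hG (hpair.trans (hasCopy_KMulti id Function.injective_id fun l => ?_))
  fin_cases l
  · exact hmono (Fin.mk_le_of_le_val (Nat.zero_le _))
  · exact hmono (Fin.mk_le_of_le_val (Nat.succ_le_of_lt (lt_of_le_of_lt (Nat.zero_le _) hij)))

theorem card_book_vertices {k n : ℕ} (hkn : k ≤ n) :
    Fintype.card (Σ i : Fin (k + 1), Fin (if (i : ℕ) < k then 1 else n - k)) = n := by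
  simp [Fin.sum_univ_castSucc, hkn]

theorem not_hasCopy_compl_joinIndep {n d k : ℕ} (hk : 1 ≤ k) (hn : k + 1 ≤ n) (q : ℕ)
    {G : SimpleGraph (Fin (n + d - 1))}
    (hG : {v : Fin (n + d - 1) | (G.neighborSet v).ncard < d}.ncard ≤ k - 1) :
    ¬ HasCopy (joinIndep G q (n - 1))ᶜ (Book k n) := by
  classical
  rintro ⟨f, hf⟩
  have hcardB := card_book_vertices (k := k) (n := n) (by omega)
  let core : Fin k → Σ i : Fin (k + 1), Fin (if (i : ℕ) < k then 1 else n - k) :=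
    fun i => ⟨i.castSucc, ⟨0, by simp⟩⟩
  have hcore : ∀ i z, z ≠ core i → (Book k n).Adj (core i) z := by
    rintro i ⟨j, y⟩ hne rfl
    apply hne
    have hy : (y : ℕ) < 1 := lt_of_lt_of_eq y.2 (if_pos i.2)
    exact congrArg (Sigma.mk _) (Fin.ext (Nat.lt_one_iff.mp hy))
  have hcoreinj : Function.Injective core := fun i j h =>
    Fin.castSucc_injective _ (congrArg Sigma.fst h)
  have hinl : ∀ i, ∃ v, f (core i) = Sum.inl v := by
    intro i
    rcases h : f (core i) with v | c
    · exact ⟨v, rfl⟩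
    · exfalso
      have himg : ∀ z, ∃ y, f z = Sum.inr (c.1, y) := by
        intro z
        by_cases hz : z = core i
        · exact ⟨c.2, by rw [hz, h]⟩
        · have := (f.map_adj (hcore i z hz)).2
          rw [h] at this
          rcases hfz : f z with v | c'
          · rw [hfz] at this
            exact absurd trivial this
          · rw [hfz] at this
            have heq : c.1 = c'.1 := not_not.mp this
            exact ⟨c'.2, by rw [heq]⟩
      choose y hy using himg
      have hyinj : Function.Injective y := fun z w hzw => hf (by rw [hy, hy, hzw])
      have := Fintype.card_le_of_injective y hyinj
      rw [hcardB, Fintype.card_fin] at this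
      omega
  choose v hv using hinl
  have hvinj : Function.Injective v := fun i j hij => hcoreinj (hf (by rw [hv, hv, hij]))
  have hlow : ∀ i, (G.neighborSet (v i)).ncard < d := by
    intro i
    have himg : ∀ z, ∃ w, f z = Sum.inl w ∧ ¬ G.Adj (v i) w := by
      intro z
      by_cases hz : z = core i
      · exact ⟨v i, by rw [hz, hv], G.irrefl⟩
      · have := (f.map_adj (hcore i z hz)).2
        rw [hv] at this
        rcases hfz : f z with w | c
        · rw [hfz] at this
          exact ⟨w, rfl, this⟩
        · rw [hfz] at this
          exact absurd trivial this
    choose w hw hwadj using himg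
    have hwinj : Function.Injective w := fun z z' h => hf (by rw [hw, hw, h])
    have hrange : (Set.range w).ncard = n := by
      rw [← Set.image_univ, Set.ncard_image_of_injective _ hwinj, Set.ncard_univ,
        Nat.card_eq_fintype_card, hcardB]
    have hdisj : Disjoint (G.neighborSet (v i)) (Set.range w) := by
      rw [Set.disjoint_right]
      rintro _ ⟨z, rfl⟩
      exact hwadj z
    have hle := Set.ncard_le_card (G.neighborSet (v i) ∪ Set.range w)
    rw [Set.ncard_union_eq hdisj, hrange] at hle
    simp only [Nat.card_eq_fintype_card, Fintype.card_fin] at hle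
    omega
  have hsub : Set.range v ⊆ {v : Fin (n + d - 1) | (G.neighborSet v).ncard < d} := by
    rintro _ ⟨i, rfl⟩
    exact hlow i
  have hle := Set.ncard_le_ncard hsub
  rw [← Set.image_univ, Set.ncard_image_of_injective _ hvinj, Set.ncard_univ,
    Nat.card_eq_fintype_card, Fintype.card_fin] at hle
  omega

/-- Observation (1.2): for `p ≥ 2`, `k ≥ 1`, `n ≥ k+1` and positive `a₁ ≤ ⋯ ≤ a_p`,
`r(K_p(a₁,…,a_p), B_{k,n}) > (p-1)(n-1) + d_k(n, K_{a₁,a₂})`. -/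
theorem ramsey_gt_dirac (p k n : ℕ) (hp : 2 ≤ p) (hk : 1 ≤ k) (hn : k + 1 ≤ n)
    (a : Fin p → ℕ) (hpos : ∀ i, 1 ≤ a i) (hmono : Monotone a) :
    (p - 1) * (n - 1) + dirac (KMulti ![a ⟨0, by omega⟩, a ⟨1, by omega⟩]) k n <
      ramseyNumber (KMulti a) (Book k n) := by
  have hadj : (KMulti ![a ⟨0, by omega⟩, a ⟨1, by omega⟩]).Adj
      ⟨0, ⟨0, hpos _⟩⟩ ⟨1, ⟨0, hpos _⟩⟩ := Fin.zero_ne_one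
  obtain ⟨G, hfree, hdeg⟩ := dirac_spec hadj k n
  have h := card_lt_ramseyNumber _ (not_hasCopy_joinIndep hp (n - 1) hmono hfree)
    (not_hasCopy_compl_joinIndep hk hn (p - 2) hdeg)
  refine lt_of_eq_of_lt ?_ h
  simp only [Fintype.card_sum, Fintype.card_prod, Fintype.card_fin]
  obtain ⟨q, rfl⟩ := Nat.exists_eq_add_of_le' hp
  obtain ⟨m, rfl⟩ := Nat.exists_eq_add_of_le' (show 1 ≤ n by omega)
  simp only [Nat.add_sub_cancel, show q + 2 - 1 = q + 1 by omega]
  rw [add_mul, add_right_comm m 1, Nat.add_sub_cancel]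
  ring
end

section
/- Let H₁ be a graph with chromatic number χ(H₁) = p ≥ 2, and let s(H₁) denote the minimum size of a color class over all proper vertex colorings of H₁ with p colors. If H₂ is a connected graph on n vertices with n ≥ s(H₁), then the Ramsey number satisfies r(H₁, H₂) ≥ (p−1)(n−1) + s(H₁). -/
open SimpleGraph

/-- `s(H)` relative to `p` colors: the minimum size of a color class over all proper vertex
colorings of `H` with `p` colors (equivalently, the minimum over all colorings and all
colors of the size of the corresponding color class). -/
noncomputable def minColorClass {V : Type*} (H : SimpleGraph V) (p : ℕ) : ℕ :=
  sInf {m : ℕ | ∃ C : H.Coloring (Fin p), ∃ c : Fin p, m = {v : V | C v = c}.ncard}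

/-- A finite Ramsey theorem for two colors, relative to a large finite set of vertices. -/
theorem exists_isNClique_or_isNClique_compl (a b : ℕ) :
    ∃ N : ℕ, ∀ {V : Type} (G : SimpleGraph V) (S : Finset V), N ≤ S.card →
      (∃ T ⊆ S, G.IsNClique a T) ∨ ∃ T ⊆ S, Gᶜ.IsNClique b T := by
  classical
  induction a generalizing b with
  | zero => exact ⟨0, fun G S _ => .inl ⟨∅, by simp, by simp [isNClique_iff]⟩⟩
  | succ a iha =>
    induction b with
    | zero => exact ⟨0, fun G S _ => .inr ⟨∅, by simp, by simp [isNClique_iff]⟩⟩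
    | succ b ihb =>
      obtain ⟨N₁, h₁⟩ := iha (b + 1)
      obtain ⟨N₂, h₂⟩ := ihb
      refine ⟨N₁ + N₂ + 1, fun {V} G S hS => ?_⟩
      obtain ⟨v, hv⟩ : S.Nonempty := Finset.card_pos.mp (by omega)
      have hsplit := Finset.card_filter_add_card_filter_not (s := S.erase v) (fun w => G.Adj v w)
      rw [Finset.card_erase_of_mem hv] at hsplit
      have hsub (q : V → Prop) [DecidablePred q] : (S.erase v).filter q ⊆ S :=
        (Finset.filter_subset _ _).trans (Finset.erase_subset _ _)
      by_cases hN : N₁ ≤ ((S.erase v).filter fun w => G.Adj v w).card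
      · rcases h₁ G _ hN with ⟨T, hT, hc⟩ | ⟨T, hT, hc⟩
        · exact .inl ⟨insert v T, Finset.insert_subset hv (hT.trans (hsub _)),
            hc.insert fun w hw => (Finset.mem_filter.mp (hT hw)).2⟩
        · exact .inr ⟨T, hT.trans (hsub _), hc⟩
      · rcases h₂ G ((S.erase v).filter fun w => ¬ G.Adj v w) (by omega) with
          ⟨T, hT, hc⟩ | ⟨T, hT, hc⟩
        · exact .inl ⟨T, hT.trans (hsub _), hc⟩
        · refine .inr ⟨insert v T, Finset.insert_subset hv (hT.trans (hsub _)),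
            hc.insert fun w hw => ?_⟩
          have hw' := Finset.mem_filter.mp (hT hw)
          exact (compl_adj _ _ _).mpr ⟨(Finset.ne_of_mem_erase hw'.1).symm, hw'.2⟩

theorem HasCopy.of_isNClique {V W : Type*} [Fintype W] {G : SimpleGraph V} {T : Finset V}
    (hT : G.IsNClique (Fintype.card W) T) (H : SimpleGraph W) : HasCopy G H := by
  obtain ⟨e⟩ : Nonempty (W ≃ T) := Fintype.card_eq.mp (by simp [hT.card_eq])
  have hinj : Function.Injective fun w => (e w : V) := Subtype.val_injective.comp e.injective
  exact ⟨⟨fun w => e w, fun {u w} h => hT.isClique (e u).2 (e w).2 (hinj.ne h.ne)⟩, hinj⟩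

theorem ramseyNumber_mem {V W : Type*} [Fintype V] [Fintype W]
    (H₁ : SimpleGraph V) (H₂ : SimpleGraph W) (G : SimpleGraph (Fin (ramseyNumber H₁ H₂))) :
    HasCopy G H₁ ∨ HasCopy Gᶜ H₂ := by
  obtain ⟨N, hN⟩ := exists_isNClique_or_isNClique_compl (Fintype.card V) (Fintype.card W)
  refine Nat.sInf_mem (s := {N : ℕ | ∀ G : SimpleGraph (Fin N), HasCopy G H₁ ∨ HasCopy Gᶜ H₂})
    ⟨N, fun G => ?_⟩ G
  rcases hN G Finset.univ (by simp) with ⟨T, -, hT⟩ | ⟨T, -, hT⟩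
  · exact .inl (.of_isNClique hT H₁)
  · exact .inr (.of_isNClique hT H₂)

theorem SimpleGraph.Connected.eq_of_forall_adj {W α : Type*} {H : SimpleGraph W}
    (hH : H.Connected) {f : W → α} (hf : ∀ u w, H.Adj u w → f u = f w) (u w : W) : f u = f w := by
  obtain ⟨q⟩ := hH.preconnected u w
  induction q with
  | nil => rfl
  | cons h _ ih => exact (hf _ _ h).trans ih

theorem minColorClass_pos {V : Type*} [Finite V] {H : SimpleGraph V} {p : ℕ} (hp : 0 < p)
    (hchi : H.chromaticNumber = (p : ℕ∞)) : 0 < minColorClass H p := by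
  obtain ⟨C⟩ : H.Colorable p := chromaticNumber_le_iff_colorable.mp hchi.le
  obtain ⟨C, c, h⟩ := Nat.sInf_mem
    (s := {m : ℕ | ∃ C : H.Coloring (Fin p), ∃ c : Fin p, m = {v : V | C v = c}.ncard})
    ⟨_, C, ⟨0, hp⟩, rfl⟩
  obtain ⟨v, hv⟩ := le_chromaticNumber_iff_forall_surjective.mp hchi.ge C c
  rw [minColorClass, h]
  exact (Set.ncard_pos).mpr ⟨v, hv⟩

/-- Burr's lower bound: if `χ(H₁) = p` and `H₂` is a connected graph on `n ≥ s(H₁)`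
vertices, then `r(H₁, H₂) ≥ (p-1)(n-1) + s(H₁)`. -/
theorem burr_lower_bound {V W : Type*} [Fintype V] [Fintype W]
    (H₁ : SimpleGraph V) (p : ℕ) (hp : 2 ≤ p) (hchi : H₁.chromaticNumber = (p : ℕ∞))
    (H₂ : SimpleGraph W) (hconn : H₂.Connected) (n : ℕ) (hcard : Fintype.card W = n)
    (hns : minColorClass H₁ p ≤ n) :
    (p - 1) * (n - 1) + minColorClass H₁ p ≤ ramseyNumber H₁ H₂ := by
  by_contra! hlt
  have hs := minColorClass_pos (by omega) hchi
  have hn : 0 < n := hs.trans_le hns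
  let f : Fin (ramseyNumber H₁ H₂) → Fin p :=
    fun v => ⟨min (v / (n - 1)) (p - 1), by omega⟩
  have hlast : {v | f v = ⟨p - 1, by omega⟩}.ncard < minColorClass H₁ p := by
    have hsub : Fin.val '' {v | f v = ⟨p - 1, by omega⟩} ⊆
        (Finset.Ico ((p - 1) * (n - 1)) (ramseyNumber H₁ H₂) : Finset ℕ) := by
      rintro _ ⟨v, hv, rfl⟩
      have hv' : p - 1 ≤ v / (n - 1) := by simpa [f] using hv
      simpa using (Nat.mul_le_mul_right _ hv').trans (Nat.div_mul_le_self _ _)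
    have := Set.ncard_le_ncard hsub
    rw [Set.ncard_image_of_injective _ Fin.val_injective, Set.ncard_coe_finset, Nat.card_Ico]
      at this
    omega
  have hclass (c : Fin p) : {v | f v = c}.ncard < n := by
    obtain hc | hc : c = ⟨p - 1, by omega⟩ ∨ (c : ℕ) < p - 1 := by
      rw [Fin.ext_iff]; change (c : ℕ) = p - 1 ∨ _; omega
    · exact hc ▸ hlast.trans_le hns
    · have hsub : Fin.val '' {v | f v = c} ⊆
          (Finset.Ico (c * (n - 1)) ((c + 1) * (n - 1)) : Finset ℕ) := by
        rintro _ ⟨v, hv, rfl⟩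
        have hv' : min ((v : ℕ) / (n - 1)) (p - 1) = c := congrArg Fin.val hv
        have hdiv : (v : ℕ) / (n - 1) = c := by omega
        have hpos : 0 < n - 1 := by
          by_contra h0
          have := v.2
          simp only [show n - 1 = 0 by omega] at hlt
          omega
        rw [Finset.coe_Ico, Set.mem_Ico, ← Nat.le_div_iff_mul_le hpos, ← Nat.div_lt_iff_lt_mul hpos]
        omega
      have := Set.ncard_le_ncard hsub
      rw [Set.ncard_image_of_injective _ Fin.val_injective, Set.ncard_coe_finset, Nat.card_Ico,
        ← Nat.sub_mul] at this
      simp only [Nat.add_sub_cancel_left, one_mul] at this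
      omega
  rcases ramseyNumber_mem H₁ H₂ ((⊤ : SimpleGraph (Fin p)).comap f) with ⟨g, hg⟩ | ⟨g, hg⟩
  · let C : H₁.Coloring (Fin p) := ⟨fun v => f (g v), fun h => g.map_adj h⟩
    have hmin : minColorClass H₁ p ≤ {v | C v = ⟨p - 1, by omega⟩}.ncard :=
      Nat.sInf_le ⟨C, _, rfl⟩
    have := Set.ncard_le_ncard_of_injOn (s := {v | C v = ⟨p - 1, by omega⟩})
      (t := {v | f v = ⟨p - 1, by omega⟩}) g (fun v hv => hv) hg.injOn
    omega
  · obtain ⟨w⟩ := hconn.nonempty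
    have hconst := hconn.eq_of_forall_adj (f := fun w => f (g w)) fun u w h => by
      simpa using ((compl_adj _ _ _).mp (g.map_adj h)).2
    have := Set.ncard_le_ncard_of_injOn (s := Set.univ) (t := {v | f v = f (g w)}) g
      (fun u _ => hconst u w) hg.injOn
    rw [Set.ncard_univ, Nat.card_eq_fintype_card, hcard] at this
    exact absurd (hclass (f (g w))) (by omega)
end

section
/- For every integer p ≥ 1, every integer n ≥ 1 and every tree T_n on n vertices, the Ramsey number satisfies r(K_p, T_n) = (p−1)(n−1) + 1. -/
open SimpleGraph

open Finset in
/-- Greedy embedding of a tree into a set `S` in which every vertex has at least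
`|T| - 1` neighbours. -/
theorem exists_tree_embedding {W : Type*} (H : SimpleGraph W) [DecidableRel H.Adj]
    (S : Finset W) (hS : S.Nonempty) (n : ℕ) {V : Type*} [Fintype V] (T : SimpleGraph V)
    (hT : T.IsTree) (hcard : Fintype.card V = n)
    (hdeg : ∀ v ∈ S, n ≤ #{w ∈ S | H.Adj v w} + 1) :
    ∃ f : T →g H, Function.Injective f ∧ ∀ v, f v ∈ S := by
  classical
  induction n generalizing V with
  | zero =>
    have := Fintype.card_eq_zero_iff.mp hcard
    exact (this.false hT.connected.nonempty.some).elim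
  | succ n ih =>
    rcases subsingleton_or_nontrivial V with hsub | hnt
    · obtain ⟨s, hs⟩ := hS
      exact ⟨⟨fun _ => s, fun {a b} h => (h.ne (Subsingleton.elim a b)).elim⟩,
        fun a b _ => Subsingleton.elim a b, fun _ => hs⟩
    obtain ⟨v, hv⟩ := hT.exists_vert_degree_one_of_nontrivial
    obtain ⟨u, huv, hu⟩ := degree_eq_one_iff_existsUnique_adj.mp hv
    have hcard' : Fintype.card ({v}ᶜ : Set V) = n := by
      rw [Fintype.card_compl_set, hcard]; simp
    obtain ⟨f, hf, hfS⟩ := ih (T.induce {v}ᶜ)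
      ⟨hT.connected.induce_compl_singleton_of_degree_eq_one hv, hT.isAcyclic.induce _⟩
      hcard' (fun w hw => by have := hdeg w hw; omega)
    let u' : ({v}ᶜ : Set V) := ⟨u, huv.ne'⟩
    obtain ⟨w, hw, hwf⟩ : ∃ w ∈ ({w ∈ S | H.Adj (f u') w} : Finset W), w ∉ (univ.image f).erase (f u') := by
      refine exists_mem_notMem_of_card_lt_card ?_
      rw [card_erase_of_mem (mem_image_of_mem f (mem_univ _)), card_image_of_injective _ hf,
        card_univ, hcard']
      have := hdeg (f u') (hfS _)
      have : 0 < n := hcard' ▸ Fintype.card_pos_iff.mpr ⟨u'⟩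
      omega
    rw [mem_filter] at hw
    have hne : ∀ x, f x ≠ w := fun x hx =>
      hwf (mem_erase.mpr ⟨hw.2.ne', hx ▸ mem_image_of_mem f (mem_univ _)⟩)
    let g : V → W := fun x => if h : x = v then w else f ⟨x, h⟩
    have hgv : g v = w := by simp [g]
    have hg (x : V) (h : x ≠ v) : g x = f ⟨x, h⟩ := by simp [g, h]
    refine ⟨⟨g, fun {a b} hab => ?_⟩, fun a b hab => ?_, fun x => ?_⟩
    · by_cases ha : a = v
      · subst ha
        obtain rfl := hu b hab
        rw [hgv, hg _ hab.ne']
        exact hw.2.symm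
      · by_cases hb : b = v
        · subst hb
          obtain rfl := hu a hab.symm
          rw [hgv, hg _ ha]
          exact hw.2
        · rw [hg _ ha, hg _ hb]
          exact f.map_adj hab
    · change g a = g b at hab
      by_cases ha : a = v <;> by_cases hb : b = v
      · rw [ha, hb]
      · rw [ha, hgv, hg _ hb] at hab
        exact (hne _ hab.symm).elim
      · rw [hb, hgv, hg _ ha] at hab
        exact (hne _ hab).elim
      · rw [hg _ ha, hg _ hb] at hab
        exact congrArg Subtype.val (hf hab)
    · change g x ∈ S
      by_cases hx : x = v
      · rw [hx, hgv]; exact hw.1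
      · rw [hg _ hx]; exact hfS _

open Finset in
theorem exists_clique_or_tree_compl {W : Type*} (G : SimpleGraph W) {V : Type*} [Fintype V]
    (T : SimpleGraph V) (hT : T.IsTree) (p : ℕ) (S : Finset W)
    (hS : p * (Fintype.card V - 1) < #S) :
    (∃ t ⊆ S, G.IsNClique (p + 1) t) ∨ HasCopy Gᶜ T := by
  classical
  induction p generalizing S with
  | zero =>
    obtain ⟨s, hs⟩ := card_pos.mp (by omega : 0 < #S)
    exact .inl ⟨{s}, by simpa using hs, by simp⟩
  | succ p ih =>
    by_cases h : ∃ v ∈ S, p * (Fintype.card V - 1) < #{w ∈ S | G.Adj v w}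
    · obtain ⟨v, hv, hlt⟩ := h
      refine (ih _ hlt).imp_left ?_
      rintro ⟨t, htS, ht⟩
      refine ⟨insert v t, insert_subset hv (htS.trans (filter_subset _ _)), ht.insert ?_⟩
      exact fun w hw => (mem_filter.mp (htS hw)).2
    · push Not at h
      obtain ⟨f, hf, -⟩ := exists_tree_embedding Gᶜ S (card_pos.mp (by omega)) _ T hT rfl
        fun v hv => by
          have h₁ : #{w ∈ S | G.Adj v w} ≤ _ := h v hv
          have h₂ : S ⊆ insert v ({w ∈ S | G.Adj v w} ∪ {w ∈ S | Gᶜ.Adj v w}) := by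
            intro w hw
            simp only [mem_insert, mem_union, mem_filter, compl_adj]
            tauto
          have h₃ := (card_le_card h₂).trans (card_insert_le _ _)
          have h₄ := card_union_le ({w ∈ S | G.Adj v w}) ({w ∈ S | Gᶜ.Adj v w})
          rw [add_mul, one_mul] at hS
          have h₅ : 0 < Fintype.card V := Fintype.card_pos_iff.mpr hT.connected.nonempty
          change _ ≤ #{w ∈ S | Gᶜ.Adj v w} + 1
          omega
      exact .inr ⟨f, hf⟩

/-- Edges join the numbers with distinct quotients by `m`: no clique on more vertices than there
are quotients, and the complement has no connected subgraph on more than `m` vertices. -/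
theorem exists_no_clique_no_connected_compl (q m N : ℕ) (hN : N ≤ q * m) {V : Type*} [Fintype V]
    (T : SimpleGraph V) (hT : T.Connected) (hV : m < Fintype.card V) :
    ∃ G : SimpleGraph (Fin N),
      ¬ HasCopy G (completeGraph (Fin (q + 1))) ∧ ¬ HasCopy Gᶜ T := by
  have hm (i : Fin N) : 0 < m := Nat.pos_of_ne_zero fun h => by
    have := i.2
    simp [h] at hN
    omega
  refine ⟨(⊤ : SimpleGraph ℕ).comap fun i : Fin N => (i : ℕ) / m, ?_, ?_⟩
  · rintro ⟨f, -⟩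
    have hlt (i : Fin (q + 1)) : (f i : ℕ) / m < q :=
      (Nat.div_lt_iff_lt_mul (hm (f i))).mpr ((f i).2.trans_le hN)
    obtain ⟨i, j, hij, h⟩ := Fintype.exists_ne_map_eq_of_card_lt
      (fun i : Fin (q + 1) => (⟨(f i : ℕ) / m, hlt i⟩ : Fin q)) (by simp)
    have hadj := f.map_adj (show (completeGraph (Fin (q + 1))).Adj i j from hij)
    exact hadj (congrArg Fin.val h)
  · rintro ⟨f, hf⟩
    have hadj (a b : V) (h : T.Adj a b) : (f a : ℕ) / m = (f b : ℕ) / m := by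
      have := f.map_adj h
      simp only [compl_adj, comap_adj, top_adj, ne_eq, not_not] at this
      exact this.2
    have hconst (a b : V) : (f a : ℕ) / m = (f b : ℕ) / m := by
      obtain ⟨w⟩ := hT.preconnected a b
      induction w with
      | nil => rfl
      | cons h _ ih => exact (hadj _ _ h).trans ih
    obtain ⟨a, b, hab, h⟩ := Fintype.exists_ne_map_eq_of_card_lt
      (fun a : V => (⟨(f a : ℕ) % m, Nat.mod_lt _ (hm (f a))⟩ : Fin m)) (by simpa using hV)
    refine hab (hf (Fin.ext ?_))
    rw [← Nat.div_add_mod (f a : ℕ) m, ← Nat.div_add_mod (f b : ℕ) m, hconst a b,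
      show (f a : ℕ) % m = f b % m from congrArg Fin.val h]

/-- Chvátal's theorem: for every `p ≥ 1`, `n ≥ 1` and every tree `T` on `n` vertices,
`r(K_p, T) = (p-1)(n-1) + 1`. -/
theorem chvatal (p n : ℕ) (hp : 1 ≤ p) (hn : 1 ≤ n) {V : Type*} [Fintype V]
    (T : SimpleGraph V) (hT : T.IsTree) (hcard : Fintype.card V = n) :
    ramseyNumber (completeGraph (Fin p)) T = (p - 1) * (n - 1) + 1 := by
  obtain ⟨q, rfl⟩ := Nat.exists_eq_add_of_le' hp
  refine IsLeast.csInf_eq ⟨fun G => ?_, fun N hN => ?_⟩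
  · refine (exists_clique_or_tree_compl G T hT q Finset.univ (by simp [hcard])).imp_left ?_
    rintro ⟨t, -, ht⟩
    have e := topEmbeddingOfNotCliqueFree fun h => h t ht
    exact ⟨e.toHom, e.injective⟩
  · by_contra! hlt
    obtain ⟨G, h₁, h₂⟩ := exists_no_clique_no_connected_compl q (n - 1) N
      (by simpa using Nat.lt_succ_iff.mp hlt) T hT.connected (by omega)
    exact (hN G).elim h₁ h₂
end
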